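/- Assume GRH for χ, i.e. every zero s of L(s,χ) with 0 < Re(s) < 1 satisfies Re(s) = 1/2. Then for every ε > 0 there exists T₀ ≥ 4 such that for every ρ' ∈ ℂ with ζ'(ρ') = 0, Re(ρ') ≥ 1 and Im(ρ') ≥ T₀, one has |L(ρ',χ)| ≤ (2·e^{C₀}·φ(q)/q + ε)·log(log(Im ρ')). (Equivalently, limsup over critical points ρ' of ζ with Re(ρ') ≥ 1 and Im(ρ') → ∞ of |L(ρ',χ)|/log log Im(ρ') is at most 2·e^{C₀}·φ(q)/q.) -/

import Mathlib

section

open Filter Topology MeasureTheory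

/-- The logarithm of the Euler factor `(1 - 1/p)⁻¹` if `n = p` is prime, and `0` otherwise. -/
noncomputable def eulerLog (n : ℕ) : ℝ := if n.Prime then -Real.log (1 - (n : ℝ)⁻¹) else 0

lemma eulerLog_prime {p : ℕ} (hp : p.Prime) : eulerLog p = -Real.log (1 - (p : ℝ)⁻¹) := if_pos hp

lemma inv_le_eulerLog {p : ℕ} (hp : p.Prime) : (p : ℝ)⁻¹ ≤ eulerLog p := by
  have h2 : (2 : ℝ) ≤ p := mod_cast hp.two_le
  have h1 : (p : ℝ)⁻¹ ≤ 2⁻¹ := inv_anti₀ (by norm_num) h2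
  rw [eulerLog_prime hp]
  have := Real.log_le_sub_one_of_pos (x := 1 - (p : ℝ)⁻¹) (by linarith)
  linarith

lemma eulerLog_nonneg (n : ℕ) : 0 ≤ eulerLog n := by
  by_cases hn : n.Prime
  · exact (by positivity : (0 : ℝ) ≤ (n : ℝ)⁻¹).trans (inv_le_eulerLog hn)
  · simp [eulerLog, hn]

lemma eulerLog_le_inv_sub_one {p : ℕ} (hp : p.Prime) : eulerLog p ≤ ((p : ℝ) - 1)⁻¹ := by
  have h2 : (2 : ℝ) ≤ p := mod_cast hp.two_le
  have h1 : (p : ℝ)⁻¹ ≤ 2⁻¹ := inv_anti₀ (by norm_num) h2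
  rw [eulerLog_prime hp]
  have := Real.one_sub_inv_le_log_of_pos (x := 1 - (p : ℝ)⁻¹) (by linarith)
  have h3 : (1 - (p : ℝ)⁻¹)⁻¹ = 1 + ((p : ℝ) - 1)⁻¹ := by
    have : (p : ℝ) - 1 ≠ 0 := by linarith
    have : (1 - (p : ℝ)⁻¹) ≠ 0 := by linarith
    field_simp
    ring
  linarith

lemma inv_sub_one_le_inv_add {p : ℝ} (h2 : 2 ≤ p) : (p - 1)⁻¹ ≤ p⁻¹ + 2 / p ^ 2 := by
  rw [inv_eq_one_div, inv_eq_one_div, div_add_div _ _ (by positivity) (by positivity),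
    div_le_div_iff₀ (by linarith) (by positivity)]
  nlinarith [mul_nonneg (sub_nonneg.2 h2) (by positivity : (0:ℝ) ≤ p)]

lemma summable_log_mul_two_div_sq : Summable fun n : ℕ ↦ Real.log n * (2 / (n : ℝ) ^ 2) := by
  have hs : Summable fun n : ℕ ↦ 4 * ((n : ℝ) ^ (3 / 2 : ℝ))⁻¹ :=
    (Real.summable_nat_rpow_inv.2 (by norm_num)).mul_left 4
  refine hs.of_nonneg_of_le (fun n ↦ by positivity) fun n ↦ ?_
  rcases Nat.eq_zero_or_pos n with rfl | hn
  · simp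
  have hn' : (0 : ℝ) < n := mod_cast hn
  have h := Real.log_le_rpow_div hn'.le (by norm_num : (0 : ℝ) < 1 / 2)
  calc Real.log n * (2 / (n : ℝ) ^ 2) ≤ ((n : ℝ) ^ (1 / 2 : ℝ) / (1 / 2)) * (2 / (n : ℝ) ^ 2) := by
        gcongr
    _ = 4 * ((n : ℝ) ^ (1 / 2 : ℝ) / (n : ℝ) ^ 2) := by ring
    _ = 4 * ((n : ℝ) ^ (3 / 2 : ℝ))⁻¹ := by
        rw [← Real.rpow_natCast, ← Real.rpow_sub hn', ← Real.rpow_neg hn'.le]; norm_num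

lemma log_factorial_eq_sum_primesLE (N : ℕ) :
    Real.log N.factorial =
      ∑ p ∈ N.primesLE, (N.factorial.factorization p : ℝ) * Real.log p := by
  conv_lhs => rw [← Nat.prod_factorization_pow_eq_self N.factorial_ne_zero]
  rw [Finsupp.prod_of_support_subset (s := N.primesLE) _ _ _ (by simp)]
  · push_cast
    rw [Real.log_prod fun p hp ↦ ?_]
    · simp
    · have := (Nat.mem_primesLE.1 hp).2.pos
      positivity
  · intro p hp
    have hp' := Nat.prime_of_mem_primeFactors hp
    exact Nat.mem_primesLE.2 ⟨(hp'.dvd_factorial).1 (Nat.dvd_of_mem_primeFactors hp), hp'⟩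

lemma factorization_factorial_le_mul_inv {p : ℕ} (hp : p.Prime) (N : ℕ) :
    (N.factorial.factorization p : ℝ) ≤ N * ((p : ℝ) - 1)⁻¹ := by
  have h2 : (2 : ℝ) ≤ p := mod_cast hp.two_le
  have : Fact p.Prime := ⟨hp⟩
  rw [Nat.factorization_def _ hp, ← div_eq_mul_inv, le_div_iff₀ (by linarith)]
  have h := (sub_one_mul_padicValNat_factorial (p := p) N).trans_le (Nat.sub_le _ _)
  rw [← Nat.cast_one, ← Nat.cast_sub hp.one_le, mul_comm]
  exact_mod_cast h

lemma div_le_factorization_factorial_add_one {p : ℕ} (hp : p.Prime) (N : ℕ) :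
    (N : ℝ) * (p : ℝ)⁻¹ ≤ N.factorial.factorization p + 1 := by
  have h : N / p ≤ N.factorial.factorization p := by
    rw [Nat.factorization_factorial hp (b := Nat.log p N + 2) (by omega)]
    calc N / p = N / p ^ 1 := by simp
      _ ≤ _ := Finset.single_le_sum (f := fun i ↦ N / p ^ i) (fun _ _ ↦ Nat.zero_le _)
          (by simp)
  rw [← div_eq_mul_inv]
  have h3 := (Nat.lt_floor_add_one ((N : ℝ) / p)).le
  rw [Nat.floor_div_natCast, Nat.floor_natCast] at h3
  have : ((N / p : ℕ) : ℝ) ≤ N.factorial.factorization p := mod_cast h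
  linarith

lemma sum_log_mul_eulerLog (N : ℕ) : ∑ n ∈ Finset.Icc 0 N, Real.log n * eulerLog n =
    ∑ p ∈ N.primesLE, Real.log p * eulerLog p := by
  symm
  refine Finset.sum_subset (fun p hp ↦ by simp [(Nat.mem_primesLE.1 hp).1]) fun n hn hn' ↦ ?_
  have : ¬ n.Prime := fun h ↦ hn' (Nat.mem_primesLE.2 ⟨(Finset.mem_Icc.1 hn).2, h⟩)
  simp [eulerLog, this]

/-- **Mertens' first theorem**, with the weights `log p / p` replaced by
`-log p * log (1 - 1 / p)`. -/
lemma exists_abs_sum_log_mul_eulerLog_sub_log_le :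
    ∃ K : ℝ, ∀ N : ℕ, 1 ≤ N →
      |∑ n ∈ Finset.Icc 0 N, Real.log n * eulerLog n - Real.log N| ≤ K := by
  set K₀ := ∑' n : ℕ, Real.log n * (2 / (n : ℝ) ^ 2)
  have hK₀ (N : ℕ) : ∑ p ∈ N.primesLE, Real.log p * (2 / (p : ℝ) ^ 2) ≤ K₀ :=
    summable_log_mul_two_div_sq.sum_le_tsum _ fun n _ ↦ by positivity
  have hlog4 : 0 ≤ Real.log 4 := Real.log_nonneg (by norm_num)
  refine ⟨K₀ + Real.log 4 + 1, fun N hN ↦ ?_⟩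
  have hN' : (0 : ℝ) < N := mod_cast hN
  have hfac : Real.log N.factorial ≤ N * Real.log N := by
    rw [← Real.log_pow]
    exact Real.log_le_log (mod_cast N.factorial_pos) (mod_cast N.factorial_le_pow)
  have hfac' : N * Real.log N - N ≤ Real.log N.factorial := by
    have h := Real.pow_div_factorial_le_exp N hN'.le N
    have h' := Real.log_le_log (by positivity) h
    rw [Real.log_div (by positivity) (by positivity), Real.log_pow, Real.log_exp] at h'
    linarith
  have hθ : ∑ p ∈ N.primesLE, Real.log p ≤ Real.log 4 * N := by
    rw [← Chebyshev.theta_eq_sum_primesLE_log]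
    exact Chebyshev.theta_le_log4_mul_x hN'.le
  rw [sum_log_mul_eulerLog, abs_le]
  have key (p : ℕ) (hp : p.Prime) : ((p : ℝ) - 1)⁻¹ ≤ (p : ℝ)⁻¹ + 2 / (p : ℝ) ^ 2 :=
    inv_sub_one_le_inv_add (mod_cast hp.two_le)
  constructor
  · have h1 : Real.log N.factorial ≤
        N * (∑ p ∈ N.primesLE, Real.log p * eulerLog p +
          ∑ p ∈ N.primesLE, Real.log p * (2 / (p : ℝ) ^ 2)) := by
      rw [log_factorial_eq_sum_primesLE, ← Finset.sum_add_distrib, Finset.mul_sum]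
      refine Finset.sum_le_sum fun p hp ↦ ?_
      have hp := (Nat.mem_primesLE.1 hp).2
      have hl : 0 ≤ Real.log p := Real.log_natCast_nonneg p
      calc _ ≤ (N * ((p : ℝ) - 1)⁻¹) * Real.log p := by
            gcongr; exact factorization_factorial_le_mul_inv hp N
        _ ≤ (N * (eulerLog p + 2 / (p : ℝ) ^ 2)) * Real.log p := by
            gcongr; linarith [key p hp, inv_le_eulerLog hp]
        _ = _ := by ring
    have h2 : N * (Real.log N - 1) ≤ N * (∑ p ∈ N.primesLE, Real.log p * eulerLog p + K₀) := by
      have := mul_le_mul_of_nonneg_left (hK₀ N) hN'.le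
      linarith
    have := le_of_mul_le_mul_left h2 hN'
    linarith
  · have h1 : N * ∑ p ∈ N.primesLE, Real.log p * eulerLog p ≤
        Real.log N.factorial + ∑ p ∈ N.primesLE, Real.log p +
          N * ∑ p ∈ N.primesLE, Real.log p * (2 / (p : ℝ) ^ 2) := by
      rw [log_factorial_eq_sum_primesLE, Finset.mul_sum, Finset.mul_sum,
        ← Finset.sum_add_distrib, ← Finset.sum_add_distrib]
      refine Finset.sum_le_sum fun p hp ↦ ?_
      have hp := (Nat.mem_primesLE.1 hp).2
      have hl : 0 ≤ Real.log p := Real.log_natCast_nonneg p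
      calc N * (Real.log p * eulerLog p) ≤
            N * (Real.log p * ((p : ℝ)⁻¹ + 2 / (p : ℝ) ^ 2)) := by
            gcongr; linarith [key p hp, eulerLog_le_inv_sub_one hp]
        _ = (N * (p : ℝ)⁻¹) * Real.log p + N * (Real.log p * (2 / (p : ℝ) ^ 2)) := by ring
        _ ≤ (N.factorial.factorization p + 1) * Real.log p +
            N * (Real.log p * (2 / (p : ℝ) ^ 2)) := by
            gcongr; exact div_le_factorization_factorial_add_one hp N
        _ = _ := by ring
    have h2 : N * ∑ p ∈ N.primesLE, Real.log p * eulerLog p ≤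
        N * (Real.log N + Real.log 4 + K₀) := by
      have := mul_le_mul_of_nonneg_left (hK₀ N) hN'.le
      linarith
    have := le_of_mul_le_mul_left h2 hN'
    linarith

lemma abs_log_sub_log_floor_le {x : ℝ} (hx : 1 ≤ x) :
    |Real.log x - Real.log ⌊x⌋₊| ≤ Real.log 2 := by
  have h1 : (1 : ℝ) ≤ ⌊x⌋₊ := mod_cast (Nat.one_le_floor_iff _).2 hx
  have h2 : (⌊x⌋₊ : ℝ) ≤ x := Nat.floor_le (by linarith)
  have h3 : x < ⌊x⌋₊ + 1 := Nat.lt_floor_add_one x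
  have h4 := Real.log_le_log (by linarith) h2
  have h5 : Real.log x ≤ Real.log (2 * ⌊x⌋₊) := Real.log_le_log (by linarith) (by linarith)
  rw [Real.log_mul (by norm_num) (by linarith)] at h5
  rw [abs_le]
  constructor <;> linarith [Real.log_nonneg (by norm_num : (1 : ℝ) ≤ 2)]

lemma hasDerivAt_neg_inv_log {t : ℝ} (ht : 1 < t) :
    HasDerivAt (fun t ↦ -(Real.log t)⁻¹) (t * Real.log t ^ 2)⁻¹ t := by
  have hl := Real.log_pos ht
  refine ((Real.hasDerivAt_log (by linarith : t ≠ 0)).fun_inv hl.ne').fun_neg.congr_deriv ?_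
  field_simp

lemma hasDerivAt_log_log {t : ℝ} (ht : 1 < t) :
    HasDerivAt (fun t ↦ Real.log (Real.log t)) (t * Real.log t)⁻¹ t := by
  have hl := Real.log_pos ht
  convert (Real.hasDerivAt_log (by linarith : t ≠ 0)).log hl.ne' using 1
  field_simp

lemma integrableOn_Ioi_two_inv_mul_log_sq :
    IntegrableOn (fun t : ℝ ↦ (t * Real.log t ^ 2)⁻¹) (Set.Ioi 2) := by
  refine integrableOn_Ioi_deriv_of_nonneg' (g := fun t ↦ -(Real.log t)⁻¹) (l := 0)
    (fun t ht ↦ hasDerivAt_neg_inv_log (by simp at ht; linarith)) (fun t ht ↦ ?_) ?_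
  · have : (0 : ℝ) < t := lt_trans (by norm_num) ht
    positivity
  · simpa using (tendsto_inv_atTop_zero.comp Real.tendsto_log_atTop).neg

/-- **Mertens' second theorem**, with `1 / p` replaced by `-log (1 - 1 / p)`. -/
lemma exists_tendsto_sum_eulerLog_sub_log_log :
    ∃ c : ℝ, Tendsto (fun x : ℝ ↦ ∑ n ∈ Finset.Icc 0 ⌊x⌋₊, eulerLog n - Real.log (Real.log x))
      atTop (𝓝 c) := by
  obtain ⟨K, hK⟩ := exists_abs_sum_log_mul_eulerLog_sub_log_le
  set C : ℝ → ℝ := fun x ↦ ∑ n ∈ Finset.Icc 0 ⌊x⌋₊, Real.log n * eulerLog n with hC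
  have hR {x : ℝ} (hx : 1 ≤ x) : |C x - Real.log x| ≤ K + Real.log 2 := by
    have h1 := hK ⌊x⌋₊ ((Nat.one_le_floor_iff _).2 hx)
    have h2 := abs_log_sub_log_floor_le hx
    rw [abs_le] at *
    constructor <;> linarith
  have hCm : Measurable C :=
    (measurable_from_nat (f := fun m ↦ ∑ n ∈ Finset.Icc 0 m, Real.log n * eulerLog n)).comp
      Nat.measurable_floor
  have hint : IntegrableOn (fun t ↦ (t * Real.log t ^ 2)⁻¹ * (C t - Real.log t)) (Set.Ioi 2) := by
    refine (integrableOn_Ioi_two_inv_mul_log_sq.mul_const (K + Real.log 2)).mono' ?_ ?_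
    · exact (by fun_prop : Measurable _).aestronglyMeasurable
    · refine (ae_restrict_iff' measurableSet_Ioi).2 (.of_forall fun t ht ↦ ?_)
      have h2 : (2 : ℝ) < t := ht
      have : 0 ≤ (t * Real.log t ^ 2)⁻¹ := by positivity
      rw [norm_mul, Real.norm_of_nonneg this, Real.norm_eq_abs]
      gcongr
      exact hR (by linarith)
  have habel {x : ℝ} (hx : 2 ≤ x) : ∑ n ∈ Finset.Icc 0 ⌊x⌋₊, eulerLog n - Real.log (Real.log x) =
      1 - Real.log (Real.log 2) + (C x - Real.log x) * (Real.log x)⁻¹ +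
        ∫ t in (2 : ℝ)..x, (t * Real.log t ^ 2)⁻¹ * (C t - Real.log t) := by
    have hd {t : ℝ} (ht : 1 < t) :
        HasDerivAt (fun t ↦ (Real.log t)⁻¹) (-(t * Real.log t ^ 2)⁻¹) t := by
      simpa using (hasDerivAt_neg_inv_log ht).fun_neg
    have hcont : ContinuousOn (fun t : ℝ ↦ -(t * Real.log t ^ 2)⁻¹) (Set.Icc 2 x) := by
      intro t ht
      have : 1 < t := by linarith [ht.1]
      have := Real.log_pos this
      have h0 : t ≠ 0 := by linarith
      have h1 : t * Real.log t ^ 2 ≠ 0 := by positivity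
      fun_prop (disch := assumption)
    have h := sum_mul_eq_sub_integral_mul₁ (f := fun t ↦ (Real.log t)⁻¹)
      (fun n ↦ Real.log n * eulerLog n) (by simp) (by simp) x
      (fun t ht ↦ (hd (by linarith [ht.1])).differentiableAt)
      ((hcont.integrableOn_Icc).congr_fun
        (fun t ht ↦ ((hd (by linarith [ht.1])).deriv).symm) measurableSet_Icc)
    have hsum : ∑ n ∈ Finset.Icc 0 ⌊x⌋₊, (Real.log n)⁻¹ * (Real.log n * eulerLog n) =
        ∑ n ∈ Finset.Icc 0 ⌊x⌋₊, eulerLog n := by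
      refine Finset.sum_congr rfl fun n _ ↦ ?_
      by_cases hn : n.Prime
      · have := Real.log_pos (mod_cast hn.one_lt : (1 : ℝ) < n)
        field_simp
      · simp [eulerLog, hn]
    rw [hsum, ← intervalIntegral.integral_of_le hx] at h
    have hlx : 0 < Real.log x := Real.log_pos (by linarith)
    have hI1 : IntervalIntegrable (fun t : ℝ ↦ (t * Real.log t)⁻¹) volume 2 x := by
      refine ContinuousOn.intervalIntegrable fun t ht ↦ ?_
      rw [Set.uIcc_of_le hx] at ht
      have : 1 < t := by linarith [ht.1]
      have := Real.log_pos this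
      have h0 : t ≠ 0 := by linarith
      have h1 : t * Real.log t ≠ 0 := by positivity
      fun_prop (disch := assumption)
    have hI2 : IntervalIntegrable (fun t ↦ (t * Real.log t ^ 2)⁻¹ * (C t - Real.log t))
        volume 2 x :=
      (intervalIntegrable_iff_integrableOn_Ioc_of_le hx).2 (hint.mono_set fun t ht ↦ ht.1)
    have hint2 : ∫ t in (2 : ℝ)..x, deriv (fun t ↦ (Real.log t)⁻¹) t * C t =
        -(Real.log (Real.log x) - Real.log (Real.log 2)) -
          ∫ t in (2 : ℝ)..x, (t * Real.log t ^ 2)⁻¹ * (C t - Real.log t) := by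
      have h3 : ∫ t in (2 : ℝ)..x, (t * Real.log t)⁻¹ =
          Real.log (Real.log x) - Real.log (Real.log 2) := by
        refine intervalIntegral.integral_eq_sub_of_hasDerivAt
          (f := fun t ↦ Real.log (Real.log t)) (fun t ht ↦ ?_) hI1
        rw [Set.uIcc_of_le hx] at ht
        exact hasDerivAt_log_log (by linarith [ht.1])
      have hI3 : IntervalIntegrable (fun t : ℝ ↦ -(t * Real.log t)⁻¹) volume 2 x := hI1.neg
      rw [← h3, ← intervalIntegral.integral_neg, ← intervalIntegral.integral_sub hI3 hI2]
      refine intervalIntegral.integral_congr fun t ht ↦ ?_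
      rw [Set.uIcc_of_le hx] at ht
      have h1 : 1 < t := by linarith [ht.1]
      have := Real.log_pos h1
      have h0 : t ≠ 0 := by linarith
      simp only [(hd h1).deriv]
      field_simp
      ring
    change _ = _ - ∫ t in (2 : ℝ)..x, deriv (fun t ↦ (Real.log t)⁻¹) t * C t at h
    rw [hint2] at h
    rw [h]
    simp only [hC]
    field_simp
    ring
  have hzero : Tendsto (fun x ↦ (C x - Real.log x) * (Real.log x)⁻¹) atTop (𝓝 0) := by
    refine squeeze_zero_norm' (a := fun x ↦ (K + Real.log 2) * (Real.log x)⁻¹) ?_ ?_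
    · filter_upwards [eventually_ge_atTop 1] with x hx
      have := Real.log_nonneg hx
      rw [norm_mul, norm_inv, Real.norm_eq_abs, Real.norm_of_nonneg this]
      gcongr
      exact hR hx
    · simpa using (tendsto_inv_atTop_zero.comp Real.tendsto_log_atTop).const_mul (K + Real.log 2)
  have hlim := intervalIntegral_tendsto_integral_Ioi 2 hint tendsto_id
  refine ⟨_, ((hzero.const_add (1 - Real.log (Real.log 2))).add hlim).congr' ?_⟩
  filter_upwards [eventually_ge_atTop 2] with x hx
  exact (habel hx).symm

lemma integral_log_mul_exp_neg :
    ∫ t in Set.Ioi (0 : ℝ), Real.log t * Real.exp (-t) = -Real.eulerMascheroniConstant := by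
  have h1 := Complex.hasDerivAt_GammaIntegral (s := 1) (by simp)
  have h2 : Complex.GammaIntegral =ᶠ[𝓝 1] Complex.Gamma := by
    filter_upwards [(isOpen_lt continuous_const Complex.continuous_re).mem_nhds
      (show (0 : ℝ) < (1 : ℂ).re by simp)] with a ha using (Complex.Gamma_eq_integral ha).symm
  have h3 := (h1.congr_of_eventuallyEq h2.symm).unique Complex.hasDerivAt_Gamma_one
  simp only [sub_self, Complex.cpow_zero, one_mul, ← Complex.ofReal_mul] at h3
  rw [integral_complex_ofReal] at h3
  exact_mod_cast h3

lemma integrableOn_log_mul_exp_neg :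
    IntegrableOn (fun t ↦ Real.log t * Real.exp (-t)) (Set.Ioi 0) := by
  refine not_imp_comm.1 integral_undef ?_
  rw [integral_log_mul_exp_neg]
  linarith [Real.one_half_lt_eulerMascheroniConstant]

lemma rpow_neg_eq_integral_exp_neg {n s : ℝ} (hn : 1 ≤ n) (hs : 0 < s) :
    ∫ v in Set.Ioi (0 : ℝ), (if n ≤ Real.exp (v / s) then Real.exp (-v) else 0) = n ^ (-s) := by
  have hn0 : 0 < n := by linarith
  have h (v : ℝ) : (if n ≤ Real.exp (v / s) then Real.exp (-v) else 0) =
      (Set.Ici (s * Real.log n)).indicator (fun v ↦ Real.exp (-v)) v := by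
    simp only [Set.indicator, Set.mem_Ici, ← Real.log_le_iff_le_exp hn0, le_div_iff₀' hs]
  have h0 : 0 ≤ s * Real.log n := mul_nonneg hs.le (Real.log_nonneg hn)
  simp_rw [h]
  rw [← integral_Ici_eq_integral_Ioi, setIntegral_indicator measurableSet_Ici, Set.Ici_inter_Ici,
    sup_eq_right.2 h0,
    integral_Ici_eq_integral_Ioi, integral_exp_neg_Ioi, Real.rpow_def_of_pos hn0]
  ring_nf

lemma eulerLog_le_two_div (n : ℕ) : eulerLog n ≤ 2 * (n : ℝ)⁻¹ := by
  by_cases hn : n.Prime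
  · refine (eulerLog_le_inv_sub_one hn).trans ?_
    have h2 : (2 : ℝ) ≤ n := mod_cast hn.two_le
    rw [inv_eq_one_div, ← div_eq_mul_inv, div_le_div_iff₀ (by linarith) (by linarith)]
    linarith
  · simp only [eulerLog, hn, if_false]
    positivity

lemma summable_eulerLog_mul_rpow {s : ℝ} (hs : 0 < s) :
    Summable fun n : ℕ ↦ eulerLog n * (n : ℝ) ^ (-s) := by
  refine ((Real.summable_nat_rpow.2 (show -1 - s < -1 by linarith)).mul_left 2).of_nonneg_of_le
    (fun n ↦ mul_nonneg (eulerLog_nonneg n) (by positivity)) fun n ↦ ?_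
  rcases Nat.eq_zero_or_pos n with rfl | hn
  · simp [eulerLog]
    positivity
  have hn0 : (0 : ℝ) < n := mod_cast hn
  calc eulerLog n * (n : ℝ) ^ (-s) ≤ 2 * (n : ℝ)⁻¹ * (n : ℝ) ^ (-s) := by
        gcongr; exact eulerLog_le_two_div n
    _ = _ := by rw [sub_eq_add_neg, Real.rpow_add hn0, Real.rpow_neg_one, mul_assoc]

lemma tsum_eulerLog_mul_rpow_eq_integral {s : ℝ} (hs : 0 < s) :
    ∑' n : ℕ, eulerLog n * (n : ℝ) ^ (-s) =
      ∫ v in Set.Ioi (0 : ℝ), (∑ n ∈ Finset.Icc 0 ⌊Real.exp (v / s)⌋₊, eulerLog n) *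
        Real.exp (-v) := by
  set F : ℕ → ℝ → ℝ := fun n v ↦
    eulerLog n * (if (n : ℝ) ≤ Real.exp (v / s) then Real.exp (-v) else 0) with hF
  have hFnn (n v) : 0 ≤ F n v := mul_nonneg (eulerLog_nonneg n) (by split_ifs <;> positivity)
  have hFint (n) : ∫ v in Set.Ioi (0 : ℝ), F n v = eulerLog n * (n : ℝ) ^ (-s) := by
    rw [integral_const_mul]
    rcases Nat.eq_zero_or_pos n with rfl | hn
    · simp [eulerLog]
    rw [rpow_neg_eq_integral_exp_neg (mod_cast hn) hs]
  have hFi (n) : IntegrableOn (F n) (Set.Ioi 0) := by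
    refine Integrable.const_mul ?_ _
    have h1 : IntegrableOn (fun v : ℝ ↦ Real.exp (-v)) (Set.Ioi 0) := integrableOn_exp_neg_Ioi 0
    refine h1.mono' ?_ (.of_forall fun v ↦ ?_)
    · refine (Measurable.ite (measurableSet_le measurable_const (by fun_prop)) (by fun_prop)
        measurable_const).aestronglyMeasurable
    · split_ifs
      · simp
      · simp; positivity
  have h := hasSum_integral_of_summable_integral_norm (F := F) (μ := volume.restrict (Set.Ioi 0))
    hFi (by
      simp only [Real.norm_of_nonneg (hFnn _ _), hFint]
      exact summable_eulerLog_mul_rpow hs)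
  simp only [hFint] at h
  rw [h.tsum_eq]
  refine integral_congr_ae (.of_forall fun v ↦ ?_)
  simp only
  rw [tsum_eq_sum (s := Finset.Icc 0 ⌊Real.exp (v / s)⌋₊), Finset.sum_mul]
  · refine Finset.sum_congr rfl fun n hn ↦ ?_
    have := Nat.le_floor_iff (by positivity) |>.1 (Finset.mem_Icc.1 hn).2
    simp [hF, this]
  · intro n hn
    have : ¬ (n : ℝ) ≤ Real.exp (v / s) := fun h ↦
      hn (Finset.mem_Icc.2 ⟨Nat.zero_le _, Nat.le_floor h⟩)
    simp [hF, this]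

lemma tendsto_tsum_eulerLog_mul_rpow_add_log {c : ℝ}
    (hc : Tendsto (fun x : ℝ ↦ ∑ n ∈ Finset.Icc 0 ⌊x⌋₊, eulerLog n - Real.log (Real.log x))
      atTop (𝓝 c)) :
    Tendsto (fun s : ℝ ↦ ∑' n : ℕ, eulerLog n * (n : ℝ) ^ (-s) + Real.log s) (𝓝[>] 0)
      (𝓝 (c - Real.eulerMascheroniConstant)) := by
  set B : ℝ → ℝ := fun x ↦ ∑ n ∈ Finset.Icc 0 ⌊x⌋₊, eulerLog n with hB
  have hB0 (x) : 0 ≤ B x := Finset.sum_nonneg fun n _ ↦ eulerLog_nonneg n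
  have hBmono : Monotone B := fun x y hxy ↦ Finset.sum_le_sum_of_subset_of_nonneg
    (Finset.Icc_subset_Icc_right (Nat.floor_mono hxy)) fun n _ _ ↦ eulerLog_nonneg n
  have hcomp : Tendsto (fun u ↦ B (Real.exp u) - Real.log u) atTop (𝓝 c) := by
    simpa [Function.comp_def] using hc.comp Real.tendsto_exp_atTop
  obtain ⟨K, hK0, hK⟩ : ∃ K, 0 ≤ K ∧ ∀ u, 0 < u →
      |B (Real.exp u) - Real.log u| ≤ K + max 0 (-Real.log u) := by
    obtain ⟨U, hU⟩ := ((eventually_ge_atTop (1 : ℝ)).and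
      (hcomp.eventually (Metric.ball_mem_nhds c one_pos))).exists_forall_of_atTop
    have hU1 := (hU U le_rfl).1
    have hlU := Real.log_nonneg hU1
    have hBU := hB0 (Real.exp U)
    refine ⟨|c| + 1 + B (Real.exp U) + Real.log U, by positivity, fun u hu ↦ ?_⟩
    have hm := le_max_left 0 (-Real.log u)
    have hm' := le_max_right 0 (-Real.log u)
    rcases le_total U u with h | h
    · have h1 := (hU u h).2
      rw [Real.dist_eq, abs_lt] at h1
      rw [abs_le]
      constructor <;> linarith [h1.1, h1.2, le_abs_self c, neg_abs_le c]
    · have h1 := hBmono (Real.exp_le_exp.2 h)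
      have h2 := Real.log_le_log hu h
      rw [abs_le]
      constructor <;> linarith [abs_nonneg c, hB0 (Real.exp u)]
  have hexp : IntegrableOn (fun v : ℝ ↦ Real.exp (-v)) (Set.Ioi 0) := integrableOn_exp_neg_Ioi 0
  have hbound : IntegrableOn (fun v ↦ (K + |Real.log v|) * Real.exp (-v)) (Set.Ioi 0) := by
    refine ((hexp.const_mul K).add integrableOn_log_mul_exp_neg.abs).congr
      (.of_forall fun v ↦ ?_)
    simp only [Pi.add_apply, abs_mul, Real.abs_exp]
    ring
  have hmeas (s : ℝ) : AEStronglyMeasurable (fun v ↦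
      (B (Real.exp (v / s)) - Real.log (v / s)) * Real.exp (-v)) (volume.restrict (Set.Ioi 0)) := by
    have : Measurable B := hBmono.measurable
    exact (by fun_prop : Measurable _).aestronglyMeasurable
  have hle {s : ℝ} (hs0 : 0 < s) (hs1 : s ≤ 1) : ∀ᵐ v ∂volume.restrict (Set.Ioi (0 : ℝ)),
      ‖(B (Real.exp (v / s)) - Real.log (v / s)) * Real.exp (-v)‖ ≤
        (K + |Real.log v|) * Real.exp (-v) := by
    refine (ae_restrict_iff' measurableSet_Ioi).2 (.of_forall fun v hv ↦ ?_)
    have hv : 0 < v := hv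
    rw [norm_mul, Real.norm_eq_abs, Real.norm_of_nonneg (Real.exp_nonneg _)]
    gcongr
    refine (hK _ (by positivity)).trans ?_
    gcongr
    refine max_le (abs_nonneg _) ?_
    rw [Real.log_div hv.ne' hs0.ne']
    linarith [neg_le_abs (Real.log v), Real.log_nonpos hs0.le hs1]
  have hev : ∀ᶠ s : ℝ in 𝓝[>] 0, 0 < s ∧ s ≤ 1 := by
    filter_upwards [Ioc_mem_nhdsGT (zero_lt_one (α := ℝ))] with s hs using hs
  have hE0 : Tendsto (fun s : ℝ ↦ ∫ v in Set.Ioi (0 : ℝ),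
      (B (Real.exp (v / s)) - Real.log (v / s)) * Real.exp (-v)) (𝓝[>] 0)
      (𝓝 (∫ v in Set.Ioi (0 : ℝ), c * Real.exp (-v))) := by
    refine tendsto_integral_filter_of_dominated_convergence _ (.of_forall hmeas)
      (hev.mono fun s hs ↦ hle hs.1 hs.2) hbound ?_
    refine (ae_restrict_iff' measurableSet_Ioi).2 (.of_forall fun v hv ↦ ?_)
    refine (hcomp.comp ?_).mul_const _
    exact (tendsto_inv_nhdsGT_zero.const_mul_atTop hv).congr fun s ↦ (div_eq_mul_inv v s).symm
  rw [integral_const_mul, integral_exp_neg_Ioi_zero, mul_one] at hE0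
  rw [sub_eq_add_neg, ← integral_log_mul_exp_neg]
  refine (hE0.add_const _).congr' ?_
  filter_upwards [hev] with s ⟨hs0, hs1⟩
  rw [tsum_eulerLog_mul_rpow_eq_integral hs0]
  have hi : IntegrableOn (fun v ↦ (B (Real.exp (v / s)) - Real.log (v / s)) * Real.exp (-v))
    (Set.Ioi 0) := hbound.mono' (hmeas s) (hle hs0 hs1)
  have hs : Real.log s = ∫ v in Set.Ioi (0 : ℝ), Real.log s * Real.exp (-v) := by
    rw [integral_const_mul, integral_exp_neg_Ioi_zero, mul_one]
  have heq : ∀ᵐ v ∂volume.restrict (Set.Ioi (0 : ℝ)),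
      (B (Real.exp (v / s)) - Real.log (v / s)) * Real.exp (-v) + Real.log v * Real.exp (-v) =
        B (Real.exp (v / s)) * Real.exp (-v) + Real.log s * Real.exp (-v) := by
    refine (ae_restrict_iff' measurableSet_Ioi).2 (.of_forall fun v hv ↦ ?_)
    rw [Real.log_div (ne_of_gt hv) hs0.ne']
    ring
  have hi2 : IntegrableOn (fun v ↦ B (Real.exp (v / s)) * Real.exp (-v)) (Set.Ioi 0) := by
    refine ((hi.add integrableOn_log_mul_exp_neg).sub (hexp.const_mul (Real.log s))).congr ?_
    filter_upwards [heq] with v hv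
    simp only [Pi.sub_apply, Pi.add_apply]
    linarith
  rw [← integral_add hi integrableOn_log_mul_exp_neg, integral_congr_ae heq,
    integral_add hi2 (hexp.const_mul _), ← hs]

lemma exp_tsum_neg_log_one_sub_rpow {s : ℝ} (hs : 1 < s) :
    (Real.exp (∑' n : ℕ, if n.Prime then -Real.log (1 - (n : ℝ) ^ (-s)) else 0) : ℂ) =
      riemannZeta s := by
  rw [← riemannZeta_eulerProduct_exp_log (by simpa using hs), Complex.ofReal_exp]
  congr 1
  rw [Complex.ofReal_tsum]
  have h : Function.support (fun n : ℕ ↦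
      ((if n.Prime then -Real.log (1 - (n : ℝ) ^ (-s)) else 0 : ℝ) : ℂ)) ⊆ {n | n.Prime} := by
    intro n hn
    by_contra h
    have h : ¬ n.Prime := h
    simp [h] at hn
  rw [← tsum_subtype_eq_of_support_subset h]
  refine tsum_congr fun p ↦ ?_
  have hp : Nat.Prime (p : ℕ) := p.2
  have h1 : (1 : ℝ) < ((p : ℕ) : ℝ) := mod_cast hp.one_lt
  have h2 : ((p : ℕ) : ℝ) ^ (-s) < 1 := Real.rpow_lt_one_of_one_lt_of_neg h1 (by linarith)
  simp only [hp, if_true]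
  rw [Complex.ofReal_neg, Complex.ofReal_log (by linarith)]
  push_cast
  rw [Complex.ofReal_cpow (by positivity)]
  push_cast
  rfl

lemma tendsto_tsum_neg_log_one_sub_rpow_add_log :
    Tendsto (fun s : ℝ ↦ ∑' n : ℕ,
      (if n.Prime then -Real.log (1 - (n : ℝ) ^ (-(1 + s))) else 0) + Real.log s) (𝓝[>] 0)
      (𝓝 0) := by
  have h1 : Tendsto (fun s : ℝ ↦ (1 + s : ℂ)) (𝓝[>] 0) (𝓝[≠] 1) := by
    refine tendsto_nhdsWithin_iff.2 ⟨?_, ?_⟩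
    · have : Tendsto (fun s : ℝ ↦ (1 + s : ℂ)) (𝓝 0) (𝓝 (1 + (0 : ℝ))) :=
        (by fun_prop : Continuous fun s : ℝ ↦ (1 + s : ℂ)).tendsto 0
      simpa using this.mono_left nhdsWithin_le_nhds
    · filter_upwards [self_mem_nhdsWithin] with s hs
      have : (s : ℂ) ≠ 0 := mod_cast (ne_of_gt hs)
      simpa using this
  have h2 := (riemannZeta_residue_one.comp h1).norm
  have h3 := (Real.continuousAt_log one_ne_zero).tendsto.comp (by simpa using h2)
  rw [Real.log_one] at h3
  refine h3.congr' ?_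
  filter_upwards [self_mem_nhdsWithin] with s hs
  have hs : 0 < s := hs
  have h4 := exp_tsum_neg_log_one_sub_rpow (s := 1 + s) (by linarith)
  rw [Complex.ofReal_add, Complex.ofReal_one] at h4
  simp only [Function.comp_apply, ← h4]
  rw [Complex.norm_real, Real.norm_eq_abs, abs_of_pos hs, Real.abs_exp,
    Real.log_mul hs.ne' (Real.exp_ne_zero _), Real.log_exp, add_comm]

lemma neg_log_one_sub_mem_Icc {x : ℝ} (h1 : x ≤ 1 / 2) :
    -Real.log (1 - x) ∈ Set.Icc x (x + 2 * x ^ 2) := by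
  have h2 := Real.log_le_sub_one_of_pos (x := 1 - x) (by linarith)
  have h3 := Real.one_sub_inv_le_log_of_pos (x := 1 - x) (by linarith)
  have h4 : (1 - x)⁻¹ ≤ 1 + x + 2 * x ^ 2 := by
    rw [inv_le_iff_one_le_mul₀ (by linarith)]
    nlinarith [mul_nonneg (sq_nonneg x) (by linarith : 0 ≤ 1 / 2 - x)]
  constructor <;> linarith

lemma rpow_neg_le_half {n s : ℝ} (hn : 2 ≤ n) (hs : 0 ≤ s) : n ^ (-(1 + s)) ≤ n⁻¹ := by
  rw [← Real.rpow_neg_one]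
  exact Real.rpow_le_rpow_of_exponent_le (by linarith) (by linarith)

lemma tendsto_tsum_neg_log_sub_tsum_eulerLog :
    Tendsto (fun s : ℝ ↦ ∑' n : ℕ, ((if n.Prime then -Real.log (1 - (n : ℝ) ^ (-(1 + s))) else 0) -
      eulerLog n * (n : ℝ) ^ (-s))) (𝓝[>] 0) (𝓝 0) := by
  have hev : ∀ᶠ s : ℝ in 𝓝[>] 0, 0 < s ∧ s ≤ 1 := by
    filter_upwards [Ioc_mem_nhdsGT (zero_lt_one (α := ℝ))] with s hs using hs
  suffices h : Tendsto _ _ (𝓝 (∑' n : ℕ, (0 : ℝ))) by rwa [tsum_zero] at h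
  refine tendsto_tsum_of_dominated_convergence (bound := fun n : ℕ ↦ 2 * ((n : ℝ) ^ 2)⁻¹)
    (Summable.mul_left _ (Real.summable_nat_pow_inv.2 one_lt_two)) (fun n ↦ ?_) ?_
  · by_cases hn : n.Prime
    · have hn2 : (2 : ℝ) ≤ n := mod_cast hn.two_le
      have hn3 : (n : ℝ)⁻¹ ≤ 2⁻¹ := inv_anti₀ (by norm_num) hn2
      have hn0 : (n : ℝ) ≠ 0 := by positivity
      have h1 : ContinuousAt (fun s : ℝ ↦ -Real.log (1 - (n : ℝ) ^ (-(1 + s))) -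
          eulerLog n * (n : ℝ) ^ (-s)) 0 := by
        have : 1 - (n : ℝ) ^ (-(1 + (0 : ℝ))) ≠ 0 := by
          rw [add_zero, Real.rpow_neg_one]; linarith
        fun_prop (disch := first | assumption | (left; assumption))
      have h2 := h1.tendsto.mono_left (nhdsWithin_le_nhds (s := Set.Ioi 0))
      simpa [hn, eulerLog, Real.rpow_neg_one] using h2
    · simp [hn, eulerLog]
  · filter_upwards [hev] with s ⟨hs0, hs1⟩ n
    by_cases hn : n.Prime
    · have hn2 : (2 : ℝ) ≤ n := mod_cast hn.two_le
      have hn3 : (n : ℝ)⁻¹ ≤ 2⁻¹ := inv_anti₀ (by norm_num) hn2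
      have hx := rpow_neg_le_half hn2 hs0.le
      have hx0 : 0 ≤ (n : ℝ) ^ (-(1 + s)) := by positivity
      obtain ⟨h1, h2⟩ := neg_log_one_sub_mem_Icc (x := (n : ℝ) ^ (-(1 + s))) (by linarith)
      have h3 := neg_log_one_sub_mem_Icc (x := (n : ℝ)⁻¹) (by linarith)
      rw [← eulerLog_prime hn] at h3
      have h4 : (n : ℝ) ^ (-(1 + s)) = (n : ℝ)⁻¹ * (n : ℝ) ^ (-s) := by
        rw [neg_add, Real.rpow_add (by linarith), Real.rpow_neg_one]
      have h5 : (n : ℝ) ^ (-s) ≤ 1 :=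
        Real.rpow_le_one_of_one_le_of_nonpos (by linarith) (by linarith)
      have h6 : 0 ≤ (n : ℝ) ^ (-s) := by positivity
      have h7 := pow_le_pow_left₀ hx0 hx 2
      have h8 : 0 ≤ ((n : ℝ)⁻¹) ^ 2 := by positivity
      simp only [hn, if_true, Real.norm_eq_abs, ← inv_pow]
      have h9 := mul_le_mul_of_nonneg_right h3.1 h6
      have h10 := mul_le_mul_of_nonneg_right h3.2 h6
      rw [abs_le]
      constructor <;> nlinarith
    · simp [hn, eulerLog]

/-- **Mertens' third theorem**, in logarithmic form. -/
theorem tendsto_sum_eulerLog_sub_log_log :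
    Tendsto (fun x : ℝ ↦ ∑ n ∈ Finset.Icc 0 ⌊x⌋₊, eulerLog n - Real.log (Real.log x))
      atTop (𝓝 Real.eulerMascheroniConstant) := by
  obtain ⟨c, hc⟩ := exists_tendsto_sum_eulerLog_sub_log_log
  have h1 := tendsto_tsum_eulerLog_mul_rpow_add_log hc
  have h2 := tendsto_tsum_neg_log_one_sub_rpow_add_log.sub tendsto_tsum_neg_log_sub_tsum_eulerLog
  rw [sub_zero] at h2
  have h3 : c - Real.eulerMascheroniConstant = 0 := by
    refine tendsto_nhds_unique h1 (h2.congr' ?_)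
    filter_upwards [self_mem_nhdsWithin] with s hs
    have hs : 0 < s := hs
    have hsum : Summable fun n : ℕ ↦
        if n.Prime then -Real.log (1 - (n : ℝ) ^ (-(1 + s))) else 0 := by
      refine ((Real.summable_nat_rpow.2 (show -(1 + s) < -1 by linarith)).mul_left 2).of_nonneg_of_le
        (fun n ↦ ?_) (fun n ↦ ?_)
      all_goals
        have hx0 : 0 ≤ (n : ℝ) ^ (-(1 + s)) := by positivity
        split_ifs with hn
        swap
        · first | exact le_rfl | positivity
        have hn2 : (2 : ℝ) ≤ n := mod_cast hn.two_le
        have hn3 : (n : ℝ)⁻¹ ≤ 2⁻¹ := inv_anti₀ (by norm_num) hn2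
        have hx := rpow_neg_le_half hn2 hs.le
        obtain ⟨h1, h2⟩ := neg_log_one_sub_mem_Icc (x := (n : ℝ) ^ (-(1 + s))) (by linarith)
        nlinarith
    rw [hsum.tsum_sub (summable_eulerLog_mul_rpow hs)]
    ring
  rwa [sub_eq_zero.1 h3] at hc

lemma DirichletCharacter.ne_one_of_isPrimitive {q : ℕ} [NeZero q] (hq : 1 < q)
    {χ : DirichletCharacter ℂ q} (hχ : χ.IsPrimitive) : χ ≠ 1 := by
  rintro rfl
  rw [DirichletCharacter.isPrimitive_def, DirichletCharacter.conductor_one] at hχ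
  omega

lemma DirichletCharacter.norm_sum_range_le {q : ℕ} [NeZero q] {χ : DirichletCharacter ℂ q}
    (hχ : χ ≠ 1) (n : ℕ) : ‖∑ k ∈ Finset.range n, χ k‖ ≤ q := by
  induction n using Nat.strong_induction_on with
  | _ n ih =>
    rcases lt_or_ge n q with h | h
    · refine (norm_sum_le_of_le (f := fun k : ℕ ↦ χ k) (n := fun _ ↦ 1) _
        fun k _ ↦ χ.norm_le_one k).trans ?_
      simpa using h.le
    · obtain ⟨m, rfl⟩ := Nat.exists_eq_add_of_le h
      have h0 : ∑ k ∈ Finset.range q, χ k = 0 := by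
        rw [← MulChar.sum_eq_zero_of_ne_one hχ]
        refine Finset.sum_nbij' (fun i ↦ (i : ZMod q)) ZMod.val (fun _ _ ↦ Finset.mem_univ _)
          (fun a _ ↦ Finset.mem_range.2 (ZMod.val_lt a))
          (fun i hi ↦ ZMod.val_cast_of_lt (Finset.mem_range.1 hi)) (fun a _ ↦ by simp)
          fun _ _ ↦ rfl
      rw [Finset.sum_range_add, h0, zero_add]
      simpa using ih m (by have := NeZero.pos q; omega)

lemma DirichletCharacter.norm_sum_Icc_le {q : ℕ} [NeZero q] (hq : 1 < q)
    {χ : DirichletCharacter ℂ q} (hχ : χ ≠ 1) (n : ℕ) : ‖∑ k ∈ Finset.Icc 1 n, χ k‖ ≤ q := by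
  have : Fact (1 < q) := ⟨hq⟩
  have h := DirichletCharacter.norm_sum_range_le hχ (n + 1)
  rwa [← Finset.sum_subset (s₁ := Finset.Icc 1 n) (fun k hk ↦ by simp at hk ⊢; omega)
    fun k hk hk' ↦ ?_] at h
  have : k = 0 := by simp at hk hk'; omega
  rw [this, Nat.cast_zero, MulChar.map_zero]

lemma DirichletCharacter.LFunction_eq_mul_integral {q : ℕ} [NeZero q] (hq : 1 < q)
    {χ : DirichletCharacter ℂ q} (hχ : χ ≠ 1) {s : ℂ} (hs : 0 < s.re) :
    DirichletCharacter.LFunction χ s =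
      s * ∫ t in Set.Ioi (1 : ℝ), (∑ k ∈ Finset.Icc 1 ⌊t⌋₊, χ k) * (t : ℂ) ^ (-(s + 1)) := by
  set S : ℝ → ℂ := fun t ↦ ∑ k ∈ Finset.Icc 1 ⌊t⌋₊, χ k with hS
  have hSle (t) : ‖S t‖ ≤ q := DirichletCharacter.norm_sum_Icc_le hq hχ _
  have hSm : Measurable S := (measurable_from_nat (f := fun m ↦ ∑ k ∈ Finset.Icc 1 m, χ k)).comp
    Nat.measurable_floor
  have hS0 {t : ℝ} (ht : t < 1) : S t = 0 := by
    simp [hS, Nat.floor_eq_zero.2 ht]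
  have hmel (z : ℂ) : mellin S (-z) = ∫ t in Set.Ioi (1 : ℝ), S t * (t : ℂ) ^ (-(z + 1)) := by
    rw [mellin]
    rw [← integral_Ici_eq_integral_Ioi (x := (1 : ℝ)),
      setIntegral_eq_of_subset_of_forall_sdiff_eq_zero measurableSet_Ioi
        (s := Set.Ici 1) (fun t (ht : 1 ≤ t) ↦ zero_lt_one.trans_le ht)]
    · refine setIntegral_congr_fun measurableSet_Ici fun t _ ↦ ?_
      simp only [smul_eq_mul]
      rw [mul_comm, neg_add']
    · intro t ht
      simp [hS0 (not_le.1 ht.2)]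
  have hdiff {z : ℂ} (hz : 0 < z.re) : DifferentiableAt ℂ (mellin S) (-z) := by
    refine mellin_differentiableAt_of_isBigO_rpow (a := 0) (b := -z.re - 1) ?_ ?_
      (by simpa using hz) ?_ (by simp)
    · refine ((locallyIntegrable_const (q : ℝ)).mono hSm.aestronglyMeasurable
        (.of_forall fun t ↦ ?_)).locallyIntegrableOn _
      simpa using hSle t
    · refine Asymptotics.IsBigO.of_bound q (.of_forall fun t ↦ ?_)
      simpa using hSle t
    · refine (Asymptotics.isBigO_zero _ _).congr' ?_ .rfl
      filter_upwards [Ioo_mem_nhdsGT (zero_lt_one (α := ℝ))] with t ht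
      exact (hS0 ht.2).symm
  set H : Set ℂ := {z | 0 < z.re} with hH
  have hHo : IsOpen H := isOpen_lt continuous_const Complex.continuous_re
  have key : Set.EqOn (DirichletCharacter.LFunction χ) (fun z ↦ z * mellin S (-z)) H := by
    refine AnalyticOnNhd.eqOn_of_preconnected_of_eventuallyEq (z₀ := 2)
      ((DirichletCharacter.differentiable_LFunction hχ).differentiableOn.analyticOnNhd hHo)
      (DifferentiableOn.analyticOnNhd (fun z hz ↦ ?_) hHo)
      (convex_halfSpace_re_gt 0).isPreconnected (by simp [hH]) ?_
    · have h1 : DifferentiableAt ℂ (fun z ↦ mellin S (-z)) z :=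
        (hdiff hz).comp z differentiableAt_id.neg
      exact (differentiableAt_id.mul h1).differentiableWithinAt
    · filter_upwards [(isOpen_lt continuous_const Complex.continuous_re).mem_nhds
        (show (1 : ℝ) < (2 : ℂ).re by simp)] with z hz
      have hz : 1 < z.re := hz
      rw [hmel, DirichletCharacter.LFunction_eq_LSeries χ hz]
      refine LSeries_eq_mul_integral _ le_rfl (by linarith)
        (DirichletCharacter.LSeriesSummable_of_one_lt_re χ hz) ?_
      refine Asymptotics.IsBigO.of_bound q (.of_forall fun n ↦ ?_)
      simpa using DirichletCharacter.norm_sum_Icc_le hq hχ n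
  rw [key hs]
  simp only
  rw [hmel]

lemma DirichletCharacter.norm_LFunction_le {q : ℕ} [NeZero q] (hq : 1 < q)
    {χ : DirichletCharacter ℂ q} (hχ : χ ≠ 1) {s : ℂ} (hs : 0 < s.re) :
    ‖DirichletCharacter.LFunction χ s‖ ≤ ‖s‖ * (q / s.re) := by
  rw [DirichletCharacter.LFunction_eq_mul_integral hq hχ hs, norm_mul]
  gcongr
  have hint : IntegrableOn (fun t : ℝ ↦ q * t ^ (-s.re - 1)) (Set.Ioi 1) :=
    (integrableOn_Ioi_rpow_of_lt (by linarith) zero_lt_one).const_mul _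
  refine (norm_integral_le_of_norm_le hint ?_).trans_eq ?_
  · refine (ae_restrict_iff' measurableSet_Ioi).2 (.of_forall fun t ht ↦ ?_)
    have ht : (1 : ℝ) < t := ht
    rw [norm_mul, Complex.norm_cpow_eq_rpow_re_of_pos (by linarith)]
    simp only [neg_add', Complex.sub_re, Complex.neg_re, Complex.one_re]
    gcongr
    exact DirichletCharacter.norm_sum_Icc_le hq hχ _
  · rw [integral_const_mul, integral_Ioi_rpow_of_lt (by linarith) zero_lt_one]
    simp
    ring

/-- The summand at `n` of the logarithm of the Euler product of `L(s, χ)`. -/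
noncomputable def eulerTerm {q : ℕ} (χ : DirichletCharacter ℂ q) (n : ℕ) (w : ℂ) : ℂ :=
  if n.Prime then -Complex.log (1 - χ n * (n : ℂ) ^ (-w)) else 0

section eulerTerm

variable {q : ℕ} (χ : DirichletCharacter ℂ q) {n : ℕ} {w : ℂ}

lemma norm_apply_mul_cpow_le (hn : 0 < n) : ‖χ n * (n : ℂ) ^ (-w)‖ ≤ (n : ℝ) ^ (-w.re) := by
  rw [norm_mul, Complex.norm_natCast_cpow_of_pos hn, Complex.neg_re]
  exact mul_le_of_le_one_left (by positivity) (χ.norm_le_one _)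

lemma norm_apply_mul_cpow_lt_one (hn : n.Prime) (hw : 0 < w.re) :
    ‖χ n * (n : ℂ) ^ (-w)‖ < 1 :=
  (norm_apply_mul_cpow_le χ hn.pos).trans_lt
    (Real.rpow_lt_one_of_one_lt_of_neg (mod_cast hn.one_lt) (by linarith))

lemma norm_eulerTerm_le (n : ℕ) (hw : 1 / 2 ≤ w.re) :
    ‖eulerTerm χ n w‖ ≤ 3 * (n : ℝ) ^ (-w.re) := by
  by_cases hn : n.Prime
  · have h1 := norm_apply_mul_cpow_le χ (w := w) hn.pos
    have h2 := norm_apply_mul_cpow_lt_one χ (w := w) hn (by linarith)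
    set z := χ n * (n : ℂ) ^ (-w)
    have h3 : ‖z‖ ≤ 5 / 7 := by
      refine h1.trans ?_
      calc (n : ℝ) ^ (-w.re) ≤ (n : ℝ) ^ (-(1 / 2 : ℝ)) :=
            Real.rpow_le_rpow_of_exponent_le (mod_cast hn.one_le) (by linarith)
        _ ≤ (2 : ℝ) ^ (-(1 / 2 : ℝ)) :=
            Real.rpow_le_rpow_of_nonpos two_pos (mod_cast hn.two_le) (by norm_num)
        _ ≤ 5 / 7 := by
            rw [Real.rpow_neg two_pos.le, ← Real.sqrt_eq_rpow,
              inv_le_comm₀ (by positivity) (by norm_num)]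
            exact Real.le_sqrt_of_sq_le (by norm_num)
    have h4 := Complex.norm_log_one_add_le (z := -z) (by rwa [norm_neg])
    rw [norm_neg, ← sub_eq_add_neg] at h4
    simp only [eulerTerm, hn, if_true, norm_neg]
    have h5 : (1 - ‖z‖)⁻¹ ≤ 7 / 2 := by
      rw [inv_le_comm₀ (by linarith) (by norm_num)]; linarith
    have h6 : ‖z‖ ^ 2 * (1 - ‖z‖)⁻¹ ≤ (5 / 7 * ‖z‖) * (7 / 2) := by
      have := norm_nonneg z
      gcongr
      nlinarith
    refine h4.trans ?_
    linarith [norm_nonneg z]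
  · simp only [eulerTerm, hn, if_false, norm_zero]
    positivity

lemma differentiableAt_eulerTerm (hw : 0 < w.re) : DifferentiableAt ℂ (eulerTerm χ n) w := by
  by_cases hn : n.Prime
  · have h2 := norm_apply_mul_cpow_lt_one χ hn hw
    have h3 : 1 - χ n * (n : ℂ) ^ (-w) ∈ Complex.slitPlane := by
      rw [sub_eq_add_neg]
      exact Complex.mem_slitPlane_of_norm_lt_one (by rwa [norm_neg])
    have h4 : DifferentiableAt ℂ (fun w : ℂ ↦ 1 - χ n * (n : ℂ) ^ (-w)) w :=
      ((differentiableAt_id.neg.const_cpow (Or.inl (mod_cast hn.ne_zero))).const_mul _).const_sub _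
    have h5 : eulerTerm χ n = fun w ↦ -Complex.log (1 - χ n * (n : ℂ) ^ (-w)) := by
      ext w; simp [eulerTerm, hn]
    rw [h5]
    exact (h4.clog h3).neg
  · have : eulerTerm χ n = fun _ ↦ 0 := by ext w; simp [eulerTerm, hn]
    rw [this]
    exact differentiableAt_const _

lemma summable_eulerTerm (hw : 1 < w.re) : Summable fun n ↦ eulerTerm χ n w :=
  .of_norm_bounded ((Real.summable_nat_rpow.2 (by linarith)).mul_left 3)
    fun n ↦ norm_eulerTerm_le χ n (by linarith)

lemma exp_tsum_eulerTerm [NeZero q] (hw : 1 < w.re) :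
    Complex.exp (∑' n, eulerTerm χ n w) = DirichletCharacter.LFunction χ w := by
  rw [DirichletCharacter.LFunction_eq_LSeries χ hw,
    ← DirichletCharacter.LSeries_eulerProduct_exp_log χ hw]
  congr 1
  have h : Function.support (fun n ↦ eulerTerm χ n w) ⊆ {n | n.Prime} := by
    intro n hn
    by_contra h
    have h : ¬ n.Prime := h
    simp [eulerTerm, h] at hn
  rw [← tsum_subtype_eq_of_support_subset h]
  refine tsum_congr fun p ↦ ?_
  have hp : Nat.Prime (p : ℕ) := p.2
  simp only [eulerTerm, hp, if_true]

lemma differentiableOn_tsum_eulerTerm :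
    DifferentiableOn ℂ (fun w ↦ ∑' n, eulerTerm χ n w) {w | 3 / 2 < w.re} := by
  refine Complex.differentiableOn_tsum_of_summable_norm
    (u := fun n : ℕ ↦ 3 * (n : ℝ) ^ (-(3 / 2) : ℝ))
    ((Real.summable_nat_rpow.2 (by norm_num)).mul_left 3) (fun n w hw ↦ ?_)
    (isOpen_lt continuous_const Complex.continuous_re) fun n w hw ↦ ?_
  all_goals have hw : 3 / 2 < w.re := hw
  · exact (differentiableAt_eulerTerm χ (by linarith)).differentiableWithinAt
  · refine (norm_eulerTerm_le χ n (by linarith)).trans ?_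
    gcongr 3 * ?_
    rcases Nat.eq_zero_or_pos n with rfl | hn
    · simp [Real.zero_rpow (by linarith : -w.re ≠ 0)]
    · exact Real.rpow_le_rpow_of_exponent_le (mod_cast hn) (by linarith)

end eulerTerm

/-- A holomorphic function without zeros on a convex open set has a holomorphic logarithm. -/
lemma exists_differentiableOn_exp_eq {U : Set ℂ} (hU : Convex ℝ U) (hUo : IsOpen U)
    (hne : U.Nonempty) {g : ℂ → ℂ} (hg : DifferentiableOn ℂ g U) (h0 : ∀ z ∈ U, g z ≠ 0) :
    ∃ f : ℂ → ℂ, DifferentiableOn ℂ f U ∧ ∀ z ∈ U, Complex.exp (f z) = g z := by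
  have := hU.contractibleSpace hne
  have hs : IsSimplyConnected U := SimplyConnectedSpace.ofContractible U
  obtain ⟨f, hfc, hf⟩ := Complex.exists_continuousOn_eqOn_exp_comp hs hUo hg.continuousOn
    (by rintro ⟨z, hz, hz0⟩; exact h0 z hz hz0)
  refine ⟨f, fun z hz ↦ ?_, hf⟩
  have hcont : ContinuousAt f z := hfc.continuousAt (hUo.mem_nhds hz)
  have hdiv : DifferentiableAt ℂ (fun y ↦ f z + Complex.log (g y / g z)) z := by
    have h1 := (hg.differentiableAt (hUo.mem_nhds hz)).div_const (g z)
    exact (h1.clog (by simp [div_self (h0 z hz)])).const_add _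
  refine (hdiv.congr_of_eventuallyEq ?_).differentiableWithinAt
  have hball := hcont.eventually (Metric.ball_mem_nhds (f z) Real.pi_pos)
  filter_upwards [hUo.mem_nhds hz, hball] with y hy hyb
  have h2 : |(f y - f z).im| < Real.pi := (Complex.abs_im_le_norm _).trans_lt (by
    rwa [← dist_eq_norm])
  rw [abs_lt] at h2
  have h3 := hf hy
  have h4 := hf hz
  simp only [Function.comp_apply] at h3 h4
  rw [← h3, ← h4, ← Complex.exp_sub, Complex.log_exp h2.1 h2.2.le]
  ring

/-- If `L(s, χ)` has no zeros with `1 / 2 < re s`, the logarithm of its Euler product continues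
holomorphically to that half plane. -/
lemma exists_log_LFunction {q : ℕ} [NeZero q] {χ : DirichletCharacter ℂ q} (hχ : χ ≠ 1)
    (h0 : ∀ s : ℂ, 1 / 2 < s.re → DirichletCharacter.LFunction χ s ≠ 0) :
    ∃ ℓ : ℂ → ℂ, DifferentiableOn ℂ ℓ {w | 1 / 2 < w.re} ∧
      (∀ w : ℂ, 1 / 2 < w.re → Complex.exp (ℓ w) = DirichletCharacter.LFunction χ w) ∧
      ∀ w : ℂ, 3 / 2 < w.re → ℓ w = ∑' n, eulerTerm χ n w := by
  obtain ⟨f, hfd, hf⟩ := exists_differentiableOn_exp_eq (convex_halfSpace_re_gt (1 / 2))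
    (isOpen_lt continuous_const Complex.continuous_re) ⟨1, by norm_num⟩
    (DirichletCharacter.differentiable_LFunction hχ).differentiableOn h0
  set V : Set ℂ := {w | 3 / 2 < w.re} with hV
  have hVo : IsOpen V := isOpen_lt continuous_const Complex.continuous_re
  set d : ℂ → ℂ := fun w ↦ f w - ∑' n, eulerTerm χ n w with hd
  have hdd : DifferentiableOn ℂ d V := (hfd.mono fun w (hw : 3 / 2 < w.re) ↦
    show 1 / 2 < w.re by linarith).sub (differentiableOn_tsum_eulerTerm χ)
  have hexp : ∀ w ∈ V, Complex.exp (d w) = 1 := by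
    intro w (hw : 3 / 2 < w.re)
    have h1 : 1 / 2 < w.re := by linarith
    rw [hd, Complex.exp_sub, hf w h1, exp_tsum_eulerTerm χ (by linarith), div_self (h0 w h1)]
  have hderiv : V.EqOn (deriv d) 0 := by
    intro w hw
    have h1 := (hdd.differentiableAt (hVo.mem_nhds hw)).hasDerivAt.cexp
    have h2 : (fun w ↦ Complex.exp (d w)) =ᶠ[𝓝 w] fun _ ↦ 1 := by
      filter_upwards [hVo.mem_nhds hw] with y hy using hexp y hy
    have h3 := (h1.congr_of_eventuallyEq h2.symm).unique (hasDerivAt_const w 1)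
    simpa [hexp w hw] using h3
  have hconst : ∀ w ∈ V, d w = d 2 := fun w hw ↦
    hVo.is_const_of_deriv_eq_zero (convex_halfSpace_re_gt _).isPreconnected hdd hderiv hw
      (by norm_num [hV])
  refine ⟨fun w ↦ f w - d 2, hfd.sub_const _, fun w hw ↦ ?_, fun w hw ↦ ?_⟩
  · rw [Complex.exp_sub, hf w hw, hexp 2 (by norm_num [hV]), div_one]
  · simp only
    rw [← hconst w hw]
    simp [hd]

lemma one_le_log_add_three {x : ℝ} (hx : 0 ≤ x) : 1 ≤ Real.log (x + 3) := by
  rw [Real.le_log_iff_exp_le (by linarith)]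
  linarith [Real.exp_one_lt_d9]

/-- A logarithm of `L(s, χ)` in the half plane `1 / 2 < re s` grows at most logarithmically on
vertical lines. -/
lemma exists_norm_log_LFunction_le {q : ℕ} [NeZero q] (hq : 1 < q) {χ : DirichletCharacter ℂ q}
    (hχ : χ ≠ 1) {ℓ : ℂ → ℂ} (hd : DifferentiableOn ℂ ℓ {w | 1 / 2 < w.re})
    (hexp : ∀ w : ℂ, 1 / 2 < w.re → Complex.exp (ℓ w) = DirichletCharacter.LFunction χ w)
    (hsum : ∀ w : ℂ, 3 / 2 < w.re → ℓ w = ∑' n, eulerTerm χ n w) {a : ℝ} (ha : 1 / 2 < a)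
    (ha1 : a ≤ 1) :
    ∃ C : ℝ, 0 ≤ C ∧ ∀ w : ℂ, a ≤ w.re → w.re ≤ 2 → ‖ℓ w‖ ≤ C * Real.log (|w.im| + 3) := by
  set A : ℝ := ∑' n : ℕ, 3 * (n : ℝ) ^ (-2 : ℝ) with hA
  have hA0 : 0 ≤ A := tsum_nonneg fun n ↦ by positivity
  have hq1 : (1 : ℝ) < q := mod_cast hq
  have hlq : 0 ≤ Real.log (4 * q) := Real.log_nonneg (by linarith)
  have hpos : 0 < 3 / 2 - (2 - a) := by linarith
  have hpos2 : 0 ≤ 2 - a := by linarith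
  refine ⟨2 * (Real.log (4 * q) + 1) * (2 - a) / (3 / 2 - (2 - a)) +
    A * (3 / 2 + (2 - a)) / (3 / 2 - (2 - a)), by positivity, fun w hw1 hw2 ↦ ?_⟩
  set τ := w.im
  have hl1 := one_le_log_add_three (abs_nonneg τ)
  set Λ := Real.log (|τ| + 3)
  set c : ℂ := ⟨2, τ⟩ with hc
  set M := (Real.log (4 * q) + 1) * Λ with hM
  have hM0 : 0 < M := by positivity
  have hmem {z : ℂ} (hz : z ∈ Metric.ball (0 : ℂ) (3 / 2)) : 1 / 2 < (c + z).re := by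
    rw [mem_ball_zero_iff] at hz
    have := (abs_le.1 (Complex.abs_re_le_norm z)).1
    simp only [Complex.add_re, hc]
    linarith
  have hdiff : DifferentiableOn ℂ (fun z ↦ ℓ (c + z)) (Metric.ball 0 (3 / 2)) :=
    hd.comp (by fun_prop) fun z hz ↦ hmem hz
  have hmaps : Set.MapsTo (fun z ↦ ℓ (c + z)) (Metric.ball 0 (3 / 2)) {z | z.re ≤ M} := by
    intro z hz
    have h1 := hmem hz
    rw [mem_ball_zero_iff] at hz
    have h2 := DirichletCharacter.norm_LFunction_le hq hχ (s := c + z) (by linarith)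
    have h3 : ‖c + z‖ ≤ |τ| + 4 := by
      have h4 := norm_add_le c z
      have h5 := Complex.norm_le_abs_re_add_abs_im c
      simp only [hc] at h5 h4 ⊢
      norm_num at h5
      linarith
    have h4 : (q : ℝ) / (c + z).re ≤ 2 * q := by
      rw [div_le_iff₀ (by linarith)]
      nlinarith
    rw [← hexp _ h1, Complex.norm_exp] at h2
    have h5 : Real.exp (ℓ (c + z)).re ≤ (4 * q) * (|τ| + 3) := by
      refine h2.trans ((mul_le_mul h3 h4 (by positivity) (by positivity)).trans ?_)
      nlinarith [abs_nonneg τ]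
    have h6 := (Real.le_log_iff_exp_le (by positivity)).2 h5
    rw [Real.log_mul (by positivity) (by positivity)] at h6
    change (ℓ (c + z)).re ≤ M
    simp only [hM]
    nlinarith
  have hw : w - c = ((w.re - 2 : ℝ) : ℂ) := by
    apply Complex.ext <;> simp [hc, τ]
  have hwn : ‖w - c‖ = 2 - w.re := by
    rw [hw, Complex.norm_real, Real.norm_eq_abs, abs_of_nonpos (by linarith)]
    ring
  have hbc := Complex.borelCaratheodory hM0 hdiff hmaps (by norm_num) (z := w - c)
    (by rw [mem_ball_zero_iff, hwn]; linarith)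
  have hℓc : ‖ℓ c‖ ≤ A := by
    rw [hsum c (by norm_num [hc])]
    exact tsum_of_norm_bounded ((Real.summable_nat_rpow.2 (by norm_num)).mul_left 3).hasSum
      fun n ↦ norm_eulerTerm_le χ n (by norm_num [hc])
  simp only [add_sub_cancel, add_zero, hwn] at hbc
  refine hbc.trans ?_
  have hden : 3 / 2 - (2 - a) ≤ 3 / 2 - (2 - w.re) := by linarith
  have h1 : 2 * M * (2 - w.re) / (3 / 2 - (2 - w.re)) ≤ 2 * M * (2 - a) / (3 / 2 - (2 - a)) := by
    gcongr
  have h2 : ‖ℓ c‖ * (3 / 2 + (2 - w.re)) / (3 / 2 - (2 - w.re)) ≤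
      A * (3 / 2 + (2 - a)) / (3 / 2 - (2 - a)) := by
    gcongr
  have h3 : 0 ≤ A * (3 / 2 + (2 - a)) / (3 / 2 - (2 - a)) := by positivity
  calc _ ≤ 2 * M * (2 - a) / (3 / 2 - (2 - a)) +
        A * (3 / 2 + (2 - a)) / (3 / 2 - (2 - a)) * Λ := by nlinarith
    _ = _ := by rw [hM]; ring

lemma mul_sum_le_sum_mul_of_antitoneOn {b f : ℕ → ℝ} (hf : AntitoneOn f (Set.Ici 1))
    (hb : ∀ n, 0 ≤ ∑ k ∈ Finset.Ioc 0 n, b k) {N : ℕ} (hN : 1 ≤ N) :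
    f N * ∑ k ∈ Finset.Ioc 0 N, b k ≤ ∑ k ∈ Finset.Ioc 0 N, b k * f k := by
  induction N, hN using Nat.le_induction with
  | base => simp [mul_comm]
  | succ N hN ih =>
    rw [Finset.sum_Ioc_succ_top (Nat.zero_le N), Finset.sum_Ioc_succ_top (Nat.zero_le N)]
    have h1 := hf (Set.mem_Ici.2 hN) (Set.mem_Ici.2 (hN.trans N.le_succ)) N.le_succ
    nlinarith [hb N, mul_le_mul_of_nonneg_right h1 (hb N)]

/-- Chebyshev's bound, weighted by a nonnegative antitone function. -/
lemma sum_prime_log_mul_le {f : ℕ → ℝ} (hf : AntitoneOn f (Set.Ici 1)) (hf0 : ∀ n, 0 ≤ f n)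
    (N : ℕ) : ∑ p ∈ Finset.Ioc 0 N with p.Prime, Real.log p * f p ≤
      Real.log 4 * ∑ n ∈ Finset.Ioc 0 N, f n := by
  rcases Nat.eq_zero_or_pos N with rfl | hN
  · simp
  have hb (n : ℕ) : 0 ≤ ∑ k ∈ Finset.Ioc 0 n, (Real.log 4 - if k.Prime then Real.log k else 0) := by
    have h := Chebyshev.theta_le_log4_mul_x (Nat.cast_nonneg (α := ℝ) n)
    rw [Chebyshev.theta, Nat.floor_natCast, Finset.sum_filter] at h
    rw [Finset.sum_sub_distrib, Finset.sum_const, Nat.card_Ioc, nsmul_eq_mul, Nat.sub_zero]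
    linarith
  have h := mul_sum_le_sum_mul_of_antitoneOn hf hb hN
  have h1 := mul_nonneg (hf0 N) (hb N)
  rw [Finset.sum_filter, Finset.mul_sum, ← sub_nonneg, ← Finset.sum_sub_distrib]
  refine (h1.trans h).trans_eq (Finset.sum_congr rfl fun n _ ↦ ?_)
  split_ifs <;> ring

lemma sum_rpow_neg_le {b : ℝ} (hb0 : 0 ≤ b) (hb1 : b < 1) (N : ℕ) :
    ∑ n ∈ Finset.Ioc 0 N, (n : ℝ) ^ (-b) ≤ (N : ℝ) ^ (1 - b) / (1 - b) := by
  induction N with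
  | zero => simp [Real.zero_rpow (by linarith : 1 - b ≠ 0)]
  | succ N ih =>
    rw [Finset.sum_Ioc_succ_top (Nat.zero_le N)]
    refine (add_le_add_left ih _).trans ?_
    rw [← le_sub_iff_add_le', ← sub_div, le_div_iff₀ (by linarith)]
    have hM : (0 : ℝ) < (N + 1 : ℕ) := by positivity
    set M : ℝ := ((N + 1 : ℕ) : ℝ) with hMdef
    have h1 := rpow_one_add_le_one_add_mul_self (s := -M⁻¹)
      (by rw [neg_le_neg_iff]; exact inv_le_one_of_one_le₀ (by simp [hMdef]))
      (by linarith : 0 ≤ 1 - b) (by linarith)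
    have h2 : (N : ℝ) = M * (1 + -M⁻¹) := by
      rw [mul_add, mul_neg, mul_inv_cancel₀ hM.ne']; simp [hMdef]
    have h3 : (0 : ℝ) ≤ 1 + -M⁻¹ := by
      rw [← sub_eq_add_neg, sub_nonneg]; exact inv_le_one_of_one_le₀ (by simp [hMdef])
    have h4 : M ^ (-b) = M ^ (1 - b) * M⁻¹ := by
      rw [← Real.rpow_neg_one, ← Real.rpow_add hM]; ring_nf
    rw [h2, Real.mul_rpow hM.le h3, h4]
    have h5 : 0 ≤ M ^ (1 - b) := by positivity
    nlinarith [mul_le_mul_of_nonneg_left h1 h5]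

lemma exists_sum_prime_rpow_neg_le {a : ℝ} (ha0 : 0 ≤ a) (ha1 : a < 1) :
    ∃ C : ℝ, 0 ≤ C ∧ ∀ N : ℕ, 2 ≤ N → ∑ p ∈ Finset.Ioc 0 N with p.Prime, (p : ℝ) ^ (-a) ≤
      C * ((N : ℝ) ^ (1 - a) / Real.log N) := by
  set η := (1 - a) / 2 with hη
  have hη0 : 0 < η := by linarith
  have hl2 := Real.log_pos (one_lt_two (α := ℝ))
  have hl4 := Real.log_pos (by norm_num : (1 : ℝ) < 4)
  refine ⟨(1 + (Real.log 2 * η)⁻¹) * (Real.log 4 / (1 - (a + η))), ?_, fun N hN ↦ ?_⟩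
  · have : 0 < 1 - (a + η) := by linarith
    positivity
  have hN2 : (2 : ℝ) ≤ N := mod_cast hN
  have hlN : 0 < Real.log N := Real.log_pos (by linarith)
  have hterm : ∀ p ∈ Finset.Ioc 0 N, p.Prime → (p : ℝ) ^ (-a) * Real.log N ≤
      (1 + (Real.log 2 * η)⁻¹) * (N : ℝ) ^ η * (Real.log p * (p : ℝ) ^ (-(a + η))) := by
    intro p hp hpp
    have hp2 : (2 : ℝ) ≤ p := mod_cast hpp.two_le
    have hpN : (p : ℝ) ≤ N := mod_cast (Finset.mem_Ioc.1 hp).2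
    have hp0 : (0 : ℝ) < p := by linarith
    have hx1 : 1 ≤ (N : ℝ) / p := (one_le_div hp0).2 hpN
    have hlp : Real.log 2 ≤ Real.log p := Real.log_le_log two_pos hp2
    have h1 : Real.log N = Real.log p + Real.log (N / p) := by
      rw [Real.log_div (by positivity) hp0.ne']; ring
    have h2 := Real.log_le_rpow_div (x := (N : ℝ) / p) (by positivity) hη0
    have h3 := Real.one_le_rpow hx1 hη0.le
    have h4 : ((N : ℝ) / p) ^ η / η ≤ (Real.log 2 * η)⁻¹ * Real.log p * ((N : ℝ) / p) ^ η := by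
      rw [mul_inv, div_eq_mul_inv]
      have : 1 ≤ (Real.log 2)⁻¹ * Real.log p := by
        rwa [inv_mul_eq_div, one_le_div hl2]
      have h5 : 0 ≤ ((N : ℝ) / p) ^ η * η⁻¹ := by positivity
      nlinarith [mul_le_mul_of_nonneg_right this h5]
    have h5 : Real.log N ≤ (1 + (Real.log 2 * η)⁻¹) * Real.log p * ((N : ℝ) / p) ^ η := by
      nlinarith [hl2.trans_le hlp]
    have h6 : ((N : ℝ) / p) ^ η = (N : ℝ) ^ η * (p : ℝ) ^ (-η) := by
      rw [Real.div_rpow (by positivity) hp0.le, Real.rpow_neg hp0.le, div_eq_mul_inv]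
    have h7 : (p : ℝ) ^ (-(a + η)) = (p : ℝ) ^ (-a) * (p : ℝ) ^ (-η) := by
      rw [neg_add, Real.rpow_add hp0]
    have h8 : 0 ≤ (p : ℝ) ^ (-a) := by positivity
    rw [h6] at h5
    calc _ ≤ _ := mul_le_mul_of_nonneg_left h5 h8
      _ = _ := by rw [h7]; ring
  have hanti : AntitoneOn (fun n : ℕ ↦ (n : ℝ) ^ (-(a + η))) (Set.Ici 1) := by
    intro m hm n _ hmn
    exact Real.rpow_le_rpow_of_nonpos
      (by simpa [Nat.pos_iff_ne_zero, Nat.one_le_iff_ne_zero] using hm) (mod_cast hmn) (by linarith)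
  have h1 := sum_prime_log_mul_le hanti (fun n ↦ by positivity) N
  have h2 := sum_rpow_neg_le (by linarith : 0 ≤ a + η) (by linarith) N
  rw [← mul_div_assoc, le_div_iff₀ hlN, Finset.sum_mul]
  calc ∑ p ∈ Finset.Ioc 0 N with p.Prime, (p : ℝ) ^ (-a) * Real.log N
      ≤ ∑ p ∈ Finset.Ioc 0 N with p.Prime,
        (1 + (Real.log 2 * η)⁻¹) * (N : ℝ) ^ η * (Real.log p * (p : ℝ) ^ (-(a + η))) :=
        Finset.sum_le_sum fun p hp ↦ hterm p (Finset.mem_filter.1 hp).1 (Finset.mem_filter.1 hp).2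
    _ ≤ (1 + (Real.log 2 * η)⁻¹) * (N : ℝ) ^ η *
        (Real.log 4 * ((N : ℝ) ^ (1 - (a + η)) / (1 - (a + η)))) := by
        rw [← Finset.mul_sum]
        gcongr
        exact h1.trans (by gcongr)
    _ = _ := by
        rw [show 1 - a = η + (1 - (a + η)) by ring, Real.rpow_add (by linarith)]
        ring

lemma sum_prime_inv_sq_le {N : ℕ} (hN : 2 ≤ N) (M : ℕ) :
    ∑ p ∈ Finset.Ioc N M with p.Prime, ((p : ℝ) ^ 2)⁻¹ ≤
      2 * Real.log 4 * ((N : ℝ) * Real.log N)⁻¹ := by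
  have hN2 : (2 : ℝ) ≤ N := mod_cast hN
  have hlN : 0 < Real.log N := Real.log_pos (by linarith)
  have hl4 := Real.log_pos (by norm_num : (1 : ℝ) < 4)
  rcases le_total M N with h | h
  · rw [Finset.Ioc_eq_empty_of_le h]
    simp
    positivity
  set f : ℕ → ℝ := fun n ↦ ((max n N : ℕ) ^ 2 : ℝ)⁻¹ with hf
  have hanti : AntitoneOn f (Set.Ici 1) := by
    intro m _ n _ hmn
    simp only [hf]
    have : (0 : ℝ) < (max m N : ℕ) := by
      have : 0 < max m N := by omega
      exact_mod_cast this
    gcongr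
  have h1 := sum_prime_log_mul_le hanti (fun n ↦ by positivity) M
  have h2 : ∑ n ∈ Finset.Ioc 0 M, f n ≤ 2 * (N : ℝ)⁻¹ := by
    rw [← Finset.sum_Ioc_consecutive f (Nat.zero_le N) h]
    have h3 : ∑ n ∈ Finset.Ioc 0 N, f n = (N : ℝ)⁻¹ := by
      rw [Finset.sum_congr rfl (g := fun _ ↦ ((N : ℝ) ^ 2)⁻¹) fun n hn ↦ by
        simp only [hf, max_eq_right (Finset.mem_Ioc.1 hn).2]]
      rw [Finset.sum_const, Nat.card_Ioc, nsmul_eq_mul, Nat.sub_zero]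
      field_simp
    have h4 : ∑ n ∈ Finset.Ioc N M, f n ≤ (N : ℝ)⁻¹ := by
      rw [Finset.sum_congr rfl (g := fun n : ℕ ↦ ((n : ℝ) ^ 2)⁻¹) fun n hn ↦ by
        simp only [hf, max_eq_left (Finset.mem_Ioc.1 hn).1.le]]
      refine (sum_Ioc_inv_sq_le_sub (by omega) h).trans ?_
      simp
    linarith
  rw [mul_inv, ← mul_assoc, ← div_eq_mul_inv _ (Real.log N), le_div_iff₀ hlN, Finset.sum_mul]
  calc ∑ p ∈ Finset.Ioc N M with p.Prime, ((p : ℝ) ^ 2)⁻¹ * Real.log N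
      ≤ ∑ p ∈ Finset.Ioc N M with p.Prime, Real.log p * f p := by
        refine Finset.sum_le_sum fun p hp ↦ ?_
        have hp := (Finset.mem_Ioc.1 (Finset.mem_filter.1 hp).1).1
        simp only [hf, max_eq_left hp.le]
        rw [mul_comm]
        gcongr
    _ ≤ ∑ p ∈ Finset.Ioc 0 M with p.Prime, Real.log p * f p := by
        refine Finset.sum_le_sum_of_subset_of_nonneg
          (Finset.filter_subset_filter _ (Finset.Ioc_subset_Ioc_left (Nat.zero_le N)))
          fun p _ _ ↦ by positivity
    _ ≤ _ := by nlinarith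

/-- The tail of the Euler product on the line `re w = 2`. -/
lemma norm_tsum_sub_sum_eulerTerm_le {q : ℕ} (χ : DirichletCharacter ℂ q) {N : ℕ} (hN : 2 ≤ N)
    {w : ℂ} (hw : w.re = 2) :
    ‖∑' n, eulerTerm χ n w - ∑ n ∈ Finset.Ioc 0 N, eulerTerm χ n w‖ ≤
      6 * Real.log 4 * ((N : ℝ) * Real.log N)⁻¹ := by
  have hs := (summable_eulerTerm χ (w := w) (by linarith)).hasSum.tendsto_sum_nat
  have h1 : Tendsto (fun M ↦ ‖∑ n ∈ Finset.range (M + 1), eulerTerm χ n w -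
      ∑ n ∈ Finset.Ioc 0 N, eulerTerm χ n w‖) atTop
      (𝓝 ‖∑' n, eulerTerm χ n w - ∑ n ∈ Finset.Ioc 0 N, eulerTerm χ n w‖) :=
    (((tendsto_add_atTop_iff_nat 1).2 hs).sub_const _).norm
  refine le_of_tendsto h1 (eventually_atTop.2 ⟨N, fun M hM ↦ ?_⟩)
  have h0 : eulerTerm χ 0 w = 0 := by simp [eulerTerm, Nat.not_prime_zero]
  have h2 : ∑ n ∈ Finset.range (M + 1), eulerTerm χ n w =
      ∑ n ∈ Finset.Ioc 0 M, eulerTerm χ n w := by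
    rw [Finset.range_eq_Ico, Finset.sum_eq_sum_Ico_succ_bot (Nat.succ_pos M), h0, zero_add]
    rfl
  rw [h2, ← Finset.sum_Ioc_consecutive _ (Nat.zero_le N) hM, add_sub_cancel_left]
  calc ‖∑ n ∈ Finset.Ioc N M, eulerTerm χ n w‖
      ≤ ∑ n ∈ Finset.Ioc N M with n.Prime, 3 * ((n : ℝ) ^ 2)⁻¹ := by
        rw [Finset.sum_filter]
        refine norm_sum_le_of_le _ fun n _ ↦ ?_
        split_ifs with hn
        · refine (norm_eulerTerm_le χ n (by linarith)).trans_eq ?_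
          rw [hw, Real.rpow_neg (Nat.cast_nonneg n), Real.rpow_two]
        · simp [eulerTerm, hn]
    _ ≤ 3 * (2 * Real.log 4 * ((N : ℝ) * Real.log N)⁻¹) := by
        rw [← Finset.mul_sum]
        gcongr
        exact sum_prime_inv_sq_le hN M
    _ = _ := by ring

lemma log_abs_add_three_mul_exp_le {τ : ℝ} (hτ : 0 ≤ τ) (y : ℝ) :
    Real.log (|τ + y| + 3) * Real.exp (-y ^ 2) ≤ 2 * Real.log (τ + 3) := by
  have h1 : |τ + y| + 3 ≤ (τ + 3) * (1 + |y|) := by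
    have := abs_add_le τ y
    rw [abs_of_nonneg hτ] at this
    nlinarith [abs_nonneg y, mul_nonneg hτ (abs_nonneg y)]
  have h2 : Real.log (|τ + y| + 3) ≤ Real.log (τ + 3) + |y| := by
    have h3 := Real.log_le_log (by positivity) h1
    rw [Real.log_mul (by positivity) (by positivity)] at h3
    have h4 := Real.log_le_sub_one_of_pos (by positivity : 0 < 1 + |y|)
    linarith
  have h3 := one_le_log_add_three hτ
  have h4 : Real.exp (-y ^ 2) ≤ 1 := Real.exp_le_one_iff.2 (by nlinarith [sq_nonneg y])
  have h5 : |y| * Real.exp (-y ^ 2) ≤ 1 := by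
    rw [Real.exp_neg, ← div_eq_mul_inv, div_le_one (Real.exp_pos _)]
    have := Real.add_one_le_exp (y ^ 2)
    nlinarith [sq_abs y, sq_nonneg (|y| - 1)]
  have h6 := Real.exp_pos (-y ^ 2)
  calc _ ≤ (Real.log (τ + 3) + |y|) * Real.exp (-y ^ 2) := by gcongr
    _ ≤ _ := by nlinarith

/-- If `L(s, χ)` has no zeros with `1 / 2 < re s`, its logarithm in `1 ≤ re s ≤ 2` is approximated
by the logarithm of a short Euler product. -/
lemma exists_norm_sub_sum_eulerTerm_le {q : ℕ} [NeZero q] (hq : 1 < q)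
    {χ : DirichletCharacter ℂ q}
    (hχ : χ ≠ 1) {ℓ : ℂ → ℂ} (hd : DifferentiableOn ℂ ℓ {w | 1 / 2 < w.re})
    (hexp : ∀ w : ℂ, 1 / 2 < w.re → Complex.exp (ℓ w) = DirichletCharacter.LFunction χ w)
    (hsum : ∀ w : ℂ, 3 / 2 < w.re → ℓ w = ∑' n, eulerTerm χ n w) {a : ℝ} (ha : 1 / 2 < a)
    (ha1 : a < 1) :
    ∃ C : ℝ, 0 ≤ C ∧ ∀ N : ℕ, 2 ≤ N → ∀ s : ℂ, 1 ≤ s.re → s.re ≤ 2 → 0 ≤ s.im →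
      Real.log (s.im + 3) ≤ (N : ℝ) ^ (1 - a) / Real.log N →
      ‖ℓ s - ∑ n ∈ Finset.Ioc 0 N, eulerTerm χ n s‖ ≤ C / Real.log N := by
  obtain ⟨C₁, hC₁, h₁⟩ := exists_norm_log_LFunction_le hq hχ hd hexp hsum ha ha1.le
  obtain ⟨C₂, hC₂, h₂⟩ := exists_sum_prime_rpow_neg_le (by linarith : 0 ≤ a) ha1
  have hl4 := Real.log_pos (by norm_num : (1 : ℝ) < 4)
  refine ⟨Real.exp 4 * (2 * C₁ + 3 * C₂ + 6 * Real.log 4), by positivity,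
    fun N hN s hs1 hs2 hτ hΛ ↦ ?_⟩
  have hN2 : (2 : ℝ) ≤ N := mod_cast hN
  have hN0 : (0 : ℝ) < N := by linarith
  have hlN : 0 < Real.log N := Real.log_pos (by linarith)
  set F : ℂ → ℂ := fun w ↦ ℓ w - ∑ n ∈ Finset.Ioc 0 N, eulerTerm χ n w with hF
  set Φ : ℂ → ℂ := fun w ↦ F w * (N : ℂ) ^ (w - 1) * Complex.exp ((w - s) ^ 2) with hΦ
  set S := (N : ℝ) ^ (1 - a) / Real.log N with hS
  have hS0 : 0 ≤ S := by positivity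
  have hFle (w : ℂ) (hw1 : a ≤ w.re) (hw2 : w.re ≤ 2) :
      ‖F w‖ ≤ C₁ * Real.log (|w.im| + 3) + 3 * C₂ * S := by
    refine (norm_sub_le _ _).trans (add_le_add (h₁ w hw1 hw2) ?_)
    calc ‖∑ n ∈ Finset.Ioc 0 N, eulerTerm χ n w‖
        ≤ ∑ n ∈ Finset.Ioc 0 N with n.Prime, 3 * (n : ℝ) ^ (-a) := by
          rw [Finset.sum_filter]
          refine norm_sum_le_of_le _ fun n _ ↦ ?_
          split_ifs with hn
          · refine (norm_eulerTerm_le χ n (by linarith)).trans ?_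
            have : (1 : ℝ) ≤ n := mod_cast hn.one_le
            gcongr
          · simp [eulerTerm, hn]
      _ ≤ _ := by
          rw [← Finset.mul_sum, mul_assoc]
          gcongr
          exact h₂ N hN
  have hexpn (w : ℂ) (hw1 : a ≤ w.re) (hw2 : w.re ≤ 2) :
      ‖Complex.exp ((w - s) ^ 2)‖ ≤ Real.exp 4 * Real.exp (-(w.im - s.im) ^ 2) := by
    rw [Complex.norm_exp, ← Real.exp_add, Real.exp_le_exp]
    simp only [sq, Complex.mul_re, Complex.sub_re, Complex.sub_im]
    nlinarith
  have hΦn (w : ℂ) : ‖Φ w‖ = ‖F w‖ * (N : ℝ) ^ (w.re - 1) * ‖Complex.exp ((w - s) ^ 2)‖ := by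
    simp only [hΦ]
    rw [norm_mul, norm_mul, Complex.norm_natCast_cpow_of_pos (by omega), Complex.sub_re,
      Complex.one_re]
  have hFe (w : ℂ) (hw1 : a ≤ w.re) (hw2 : w.re ≤ 2) :
      ‖F w‖ * ‖Complex.exp ((w - s) ^ 2)‖ ≤ Real.exp 4 * ((2 * C₁ + 3 * C₂) * S) := by
    have h3 := log_abs_add_three_mul_exp_le hτ (w.im - s.im)
    rw [add_sub_cancel] at h3
    have h4 : Real.exp (-(w.im - s.im) ^ 2) ≤ 1 :=
      Real.exp_le_one_iff.2 (by nlinarith [sq_nonneg (w.im - s.im)])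
    have h5 : 0 ≤ 3 * C₂ * S := by positivity
    have h6 : 0 ≤ Real.log (|w.im| + 3) := by linarith [one_le_log_add_three (abs_nonneg w.im)]
    calc _ ≤ (C₁ * Real.log (|w.im| + 3) + 3 * C₂ * S) *
          (Real.exp 4 * Real.exp (-(w.im - s.im) ^ 2)) := by
          gcongr
          · exact hFle w hw1 hw2
          · exact hexpn w hw1 hw2
      _ = Real.exp 4 * (C₁ * (Real.log (|w.im| + 3) * Real.exp (-(w.im - s.im) ^ 2)) +
          3 * C₂ * S * Real.exp (-(w.im - s.im) ^ 2)) := by ring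
      _ ≤ Real.exp 4 * (C₁ * (2 * S) + 3 * C₂ * S * 1) := by
          have h7 := h3.trans (mul_le_mul_of_nonneg_left hΛ zero_le_two)
          gcongr
      _ = _ := by ring
  have hclos : closure (Complex.re ⁻¹' Set.Ioo a 2) ⊆ Complex.re ⁻¹' Set.Icc a 2 :=
    closure_minimal (Set.preimage_mono Set.Ioo_subset_Icc_self)
      (isClosed_Icc.preimage Complex.continuous_re)
  have hopen : IsOpen {w : ℂ | 1 / 2 < w.re} := isOpen_lt continuous_const Complex.continuous_re
  have hdiff : DiffContOnCl ℂ Φ (Complex.re ⁻¹' Set.Ioo a 2) := by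
    refine DifferentiableOn.diffContOnCl fun w hw ↦ ?_
    have hw1 : 1 / 2 < w.re := ha.trans_le (hclos hw).1
    have h3 : DifferentiableAt ℂ ℓ w := hd.differentiableAt (hopen.mem_nhds hw1)
    have h4 : DifferentiableAt ℂ (fun w ↦ ∑ n ∈ Finset.Ioc 0 N, eulerTerm χ n w) w :=
      DifferentiableAt.fun_sum fun n _ ↦ differentiableAt_eulerTerm χ (by linarith)
    have h5 : DifferentiableAt ℂ (fun w : ℂ ↦ (N : ℂ) ^ (w - 1)) w :=
      (differentiableAt_id.sub_const 1).const_cpow (Or.inl (by exact_mod_cast hN0.ne'))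
    have h6 : DifferentiableAt ℂ (fun w : ℂ ↦ Complex.exp ((w - s) ^ 2)) w := by fun_prop
    exact (((h3.sub h4).mul h5).mul h6).differentiableWithinAt
  have hmain : ‖Φ s‖ ≤ Real.exp 4 * (2 * C₁ + 3 * C₂ + 6 * Real.log 4) / Real.log N := by
    refine PhragmenLindelof.vertical_strip (a := a) (b := 2) hdiff ⟨0, ?_, 0, ?_⟩ ?_ ?_
      (by linarith) hs2
    · have : 0 < 2 - a := by linarith
      positivity
    · refine Asymptotics.IsBigO.of_bound (Real.exp 4 * ((2 * C₁ + 3 * C₂) * S) * N) ?_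
      filter_upwards [mem_inf_of_right (mem_principal_self _)] with w hw
      have h3 : (N : ℝ) ^ (w.re - 1) ≤ N := by
        calc _ ≤ (N : ℝ) ^ (1 : ℝ) :=
              Real.rpow_le_rpow_of_exponent_le (by linarith) (by linarith [hw.2])
          _ = N := Real.rpow_one _
      rw [hΦn, mul_right_comm]
      simp only [zero_mul, Real.exp_zero, norm_one, mul_one]
      have := hFe w hw.1.le hw.2.le
      gcongr
    · intro w hw
      rw [hΦn, mul_right_comm, le_div_iff₀ hlN]
      have h3 := hFe w hw.ge (by linarith)
      have h4 : (N : ℝ) ^ (1 - a) * (N : ℝ) ^ (w.re - 1) = 1 := by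
        rw [← Real.rpow_add hN0, hw]; simp
      have h5 : S * (N : ℝ) ^ (w.re - 1) * Real.log N = 1 := by
        
        rw [hS, div_mul_eq_mul_div, div_mul_cancel₀ _ hlN.ne', h4]
      calc _ ≤ Real.exp 4 * ((2 * C₁ + 3 * C₂) * S) * (N : ℝ) ^ (w.re - 1) * Real.log N := by
            gcongr
        _ = Real.exp 4 * (2 * C₁ + 3 * C₂) * (S * (N : ℝ) ^ (w.re - 1) * Real.log N) := by ring
        _ ≤ _ := by
            rw [h5, mul_one]
            exact mul_le_mul_of_nonneg_left (by linarith) (Real.exp_pos 4).le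
    · intro w hw
      have h3 := norm_tsum_sub_sum_eulerTerm_le χ hN hw
      rw [← hsum w (by linarith)] at h3
      have h4 : (N : ℝ) ^ (w.re - 1) = N := by rw [hw]; norm_num
      have h5 : ‖Complex.exp ((w - s) ^ 2)‖ ≤ Real.exp 4 := by
        refine (hexpn w (by linarith) hw.le).trans (mul_le_of_le_one_right (Real.exp_pos _).le ?_)
        exact Real.exp_le_one_iff.2 (by nlinarith [sq_nonneg (w.im - s.im)])
      rw [hΦn, h4]
      calc _ ≤ 6 * Real.log 4 * ((N : ℝ) * Real.log N)⁻¹ * N * Real.exp 4 := by gcongr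
        _ = Real.exp 4 * (6 * Real.log 4) / Real.log N := by field_simp
        _ ≤ _ := div_le_div_of_nonneg_right
            (mul_le_mul_of_nonneg_left (by linarith) (Real.exp_pos 4).le) hlN.le
  refine le_trans ?_ hmain
  rw [hΦn, sub_self]
  have h3 : 1 ≤ (N : ℝ) ^ (s.re - 1) := Real.one_le_rpow (by linarith) (by linarith)
  simp only [ne_eq, OfNat.ofNat_ne_zero, not_false_eq_true, zero_pow, Complex.exp_zero, norm_one,
    mul_one]
  exact le_mul_of_one_le_right (norm_nonneg _) h3

lemma re_eulerTerm_le {q : ℕ} (χ : DirichletCharacter ℂ q) (n : ℕ) {w : ℂ} (hw : 1 ≤ w.re) :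
    (eulerTerm χ n w).re ≤ eulerLog n := by
  by_cases hn : n.Prime
  · have hn2 : (2 : ℝ) ≤ n := mod_cast hn.two_le
    have h1 : ‖χ n * (n : ℂ) ^ (-w)‖ ≤ (n : ℝ)⁻¹ := by
      refine (norm_apply_mul_cpow_le χ hn.pos).trans ?_
      rw [← Real.rpow_neg_one]
      exact Real.rpow_le_rpow_of_exponent_le (by linarith) (by linarith)
    have h2 : (n : ℝ)⁻¹ ≤ 2⁻¹ := by gcongr
    have h3 := norm_sub_norm_le (1 : ℂ) (χ n * (n : ℂ) ^ (-w))
    rw [norm_one] at h3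
    simp only [eulerTerm, eulerLog, hn, if_true, Complex.neg_re, Complex.log_re]
    exact neg_le_neg (Real.log_le_log (by linarith) (by linarith))
  · simp [eulerTerm, eulerLog, hn]

lemma eulerTerm_eq_zero_of_dvd {q : ℕ} (χ : DirichletCharacter ℂ q) {n : ℕ} (hn : n.Prime)
    (hnq : n ∣ q) (w : ℂ) : eulerTerm χ n w = 0 := by
  have h : χ n = 0 := by
    refine χ.map_nonunit fun hu ↦ ?_
    rw [ZMod.isUnit_iff_coprime] at hu
    exact hn.ne_one (Nat.Coprime.eq_one_of_dvd hu hnq)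
  simp [eulerTerm, h]

lemma sum_primeFactors_eulerLog {q : ℕ} (hq : q ≠ 0) :
    ∑ p ∈ q.primeFactors, eulerLog p = -Real.log ((q.totient : ℝ) / q) := by
  have h1 : (q.totient : ℝ) = q * ∏ p ∈ q.primeFactors, (1 - (p : ℝ)⁻¹) := by
    have h := congrArg (Rat.cast : ℚ → ℝ) (Nat.totient_eq_mul_prod_factors q)
    push_cast at h
    exact h
  have hq0 : (q : ℝ) ≠ 0 := mod_cast hq
  rw [h1, mul_div_cancel_left₀ _ hq0, Real.log_prod, ← Finset.sum_neg_distrib]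
  · exact Finset.sum_congr rfl fun p hp ↦ eulerLog_prime (Nat.prime_of_mem_primeFactors hp)
  · intro p hp
    have hp2 : (2 : ℝ) ≤ p := mod_cast (Nat.prime_of_mem_primeFactors hp).two_le
    have h2 : (p : ℝ)⁻¹ ≤ 2⁻¹ := by gcongr
    linarith

lemma re_sum_eulerTerm_le {q : ℕ} (hq : q ≠ 0) (χ : DirichletCharacter ℂ q) {N : ℕ} (hN : q ≤ N)
    {w : ℂ} (hw : 1 ≤ w.re) :
    (∑ n ∈ Finset.Ioc 0 N, eulerTerm χ n w).re ≤
      ∑ n ∈ Finset.Icc 0 N, eulerLog n + Real.log ((q.totient : ℝ) / q) := by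
  have hsub : q.primeFactors ⊆ Finset.Ioc 0 N := fun p hp ↦ Finset.mem_Ioc.2
    ⟨(Nat.prime_of_mem_primeFactors hp).pos, (Nat.le_of_mem_primeFactors hp).trans hN⟩
  have h1 : ∑ n ∈ Finset.Ioc 0 N, eulerLog n ≤ ∑ n ∈ Finset.Icc 0 N, eulerLog n :=
    Finset.sum_le_sum_of_subset_of_nonneg Finset.Ioc_subset_Icc_self fun n _ _ ↦ eulerLog_nonneg n
  have h2 := sum_primeFactors_eulerLog hq
  rw [← Finset.sum_sdiff hsub] at h1 ⊢
  rw [Finset.sum_eq_zero (s := q.primeFactors) fun p hp ↦ eulerTerm_eq_zero_of_dvd χ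
    (Nat.prime_of_mem_primeFactors hp) (Nat.dvd_of_mem_primeFactors hp) w, add_zero, Complex.re_sum]
  have h3 := Finset.sum_le_sum fun n (_ : n ∈ Finset.Ioc 0 N \ q.primeFactors) ↦
    re_eulerTerm_le χ n hw
  linarith

lemma norm_LFunction_le_of_two_le_re {q : ℕ} [NeZero q] (χ : DirichletCharacter ℂ q) {w : ℂ}
    (hw : 2 ≤ w.re) :
    ‖DirichletCharacter.LFunction χ w‖ ≤ Real.exp (∑' n : ℕ, 3 * (n : ℝ) ^ (-2 : ℝ)) := by
  rw [← exp_tsum_eulerTerm χ (by linarith), Complex.norm_exp, Real.exp_le_exp]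
  refine (Complex.re_le_norm _).trans ?_
  refine tsum_of_norm_bounded
    ((Real.summable_nat_rpow.2 (by norm_num)).mul_left (3 : ℝ)).hasSum fun n ↦ ?_
  by_cases hn : n.Prime
  · refine (norm_eulerTerm_le χ n (by linarith)).trans ?_
    have : (1 : ℝ) ≤ n := mod_cast hn.one_le
    gcongr
  · simp only [eulerTerm, hn, if_false, norm_zero]
    positivity

/-- The length of the Euler product approximating `L(s, χ)` at height `τ`. -/
lemma eventually_log_add_three_le {κ b : ℝ} (hκ : 0 < κ) (hb : 0 < b) (hκb : 1 < κ * b) :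
    ∀ᶠ τ : ℝ in atTop, Real.log (τ + 3) ≤
      (⌊Real.log τ ^ κ⌋₊ : ℝ) ^ b / Real.log ⌊Real.log τ ^ κ⌋₊ := by
  have h1 : ∀ᶠ X : ℝ in atTop, 2 * X * (κ * Real.log X) ≤ (X ^ κ / 2) ^ b := by
    have h2 := (isLittleO_log_rpow_atTop (by linarith : 0 < κ * b - 1)).bound
      (by positivity : 0 < (2 : ℝ)⁻¹ ^ b / (2 * κ))
    filter_upwards [h2, eventually_ge_atTop 1] with X hX hX1
    have hX0 : 0 < X := by linarith
    rw [Real.norm_of_nonneg (Real.log_nonneg hX1), Real.norm_of_nonneg (by positivity),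
      Real.rpow_sub_one hX0.ne', div_mul_div_comm, le_div_iff₀ (by positivity)] at hX
    rw [div_eq_mul_inv, Real.mul_rpow (by positivity) (by norm_num), ← Real.rpow_mul hX0.le]
    linarith
  have h2 : ∀ᶠ X : ℝ in atTop, 4 ≤ X ^ κ := (tendsto_rpow_atTop hκ).eventually_ge_atTop 4
  filter_upwards [Real.tendsto_log_atTop.eventually h1, Real.tendsto_log_atTop.eventually h2,
    eventually_ge_atTop 3] with τ hτ1 hτ2 hτ3
  set X := Real.log τ with hX
  have hX1 : 1 < X := (Real.lt_log_iff_exp_lt (by linarith)).2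
    (by linarith [Real.exp_one_lt_d9])
  have h3 : Real.log (τ + 3) ≤ 2 * X := by
    rw [hX, two_mul, ← Real.log_mul (by positivity) (by positivity)]
    exact Real.log_le_log (by linarith) (by nlinarith)
  have h4 : (⌊X ^ κ⌋₊ : ℝ) ≤ X ^ κ := Nat.floor_le (by positivity)
  have h5 : X ^ κ / 2 ≤ (⌊X ^ κ⌋₊ : ℝ) := by linarith [Nat.lt_floor_add_one (X ^ κ)]
  have h6 : Real.log (⌊X ^ κ⌋₊ : ℝ) ≤ κ * Real.log X := by
    rw [← Real.log_rpow (by linarith)]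
    exact Real.log_le_log (by linarith) h4
  rw [le_div_iff₀ (Real.log_pos (by linarith))]
  have h7 := Real.log_pos hX1
  calc _ ≤ 2 * X * (κ * Real.log X) := by
        gcongr
    _ ≤ (X ^ κ / 2) ^ b := hτ1
    _ ≤ _ := by gcongr

/-- Littlewood's conditional bound for `L(s, χ)` to the right of the line `re s = 1`. -/
lemma eventually_norm_LFunction_le {q : ℕ} [NeZero q] (hq : 1 < q) {χ : DirichletCharacter ℂ q}
    (hχ : χ ≠ 1) (h0 : ∀ s : ℂ, 1 / 2 < s.re → DirichletCharacter.LFunction χ s ≠ 0) {c : ℝ}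
    (hc : 2 * Real.exp Real.eulerMascheroniConstant * ((q.totient : ℝ) / q) < c) :
    ∀ᶠ τ : ℝ in atTop, ∀ s : ℂ, 1 ≤ s.re → s.im = τ →
      ‖DirichletCharacter.LFunction χ s‖ ≤ c * Real.log (Real.log τ) := by
  obtain ⟨ℓ, hd, hexp, hsum⟩ := exists_log_LFunction hχ h0
  have hφ : 0 < (q.totient : ℝ) / q := by
    have : 0 < q.totient := Nat.totient_pos.2 (by omega)
    positivity
  set B := (q.totient : ℝ) / q with hB
  set g := Real.exp Real.eulerMascheroniConstant with hg
  have hg0 : 0 < g := Real.exp_pos _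
  obtain ⟨κ, hκ2, hκc⟩ : ∃ κ : ℝ, 2 < κ ∧ κ < c / (g * B) :=
    exists_between (by rw [lt_div_iff₀ (by positivity)]; linarith)
  rw [lt_div_iff₀ (by positivity)] at hκc
  have hκ0 : 0 < κ := by linarith
  obtain ⟨b, hb1, hb2⟩ : ∃ b : ℝ, κ⁻¹ < b ∧ b < 1 / 2 :=
    exists_between (by rw [one_div]; exact (inv_lt_inv₀ hκ0 two_pos).2 hκ2)
  have hb0 : 0 < b := (inv_pos.2 hκ0).trans hb1
  have hκb : 1 < κ * b := (inv_lt_iff_one_lt_mul₀' hκ0).1 hb1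
  obtain ⟨C, hC, hF⟩ := exists_norm_sub_sum_eulerTerm_le hq hχ hd hexp hsum
    (by linarith : 1 / 2 < 1 - b) (by linarith)
  have hcpos : 0 < c := by
    have : 0 < 2 * g * B := by positivity
    linarith
  have hN : Tendsto (fun τ : ℝ ↦ ⌊Real.log τ ^ κ⌋₊) atTop atTop :=
    tendsto_nat_floor_atTop.comp ((tendsto_rpow_atTop hκ0).comp Real.tendsto_log_atTop)
  have hlim : Tendsto (fun N : ℕ ↦ B * κ * Real.exp (C / Real.log N +
      (∑ n ∈ Finset.Icc 0 N, eulerLog n - Real.log (Real.log N)))) atTop (𝓝 (B * κ * g)) := by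
    have h1 : Tendsto (fun N : ℕ ↦ C / Real.log N) atTop (𝓝 0) :=
      tendsto_const_nhds.div_atTop (Real.tendsto_log_atTop.comp tendsto_natCast_atTop_atTop)
    have h2 := tendsto_sum_eulerLog_sub_log_log.comp (tendsto_natCast_atTop_atTop (R := ℝ))
    simp only [Function.comp_def, Nat.floor_natCast] at h2
    have h3 := (h1.add h2).rexp.const_mul (B * κ)
    rwa [zero_add] at h3
  have hll : Tendsto (fun τ : ℝ ↦ Real.log (Real.log τ)) atTop atTop :=
    Real.tendsto_log_atTop.comp Real.tendsto_log_atTop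
  filter_upwards [hN.eventually (hlim.eventually_lt_const (by linarith : B * κ * g < c)),
    hN.eventually_ge_atTop q, eventually_log_add_three_le hκ0 hb0 hκb, eventually_ge_atTop 4,
    hll.eventually_ge_atTop (Real.exp (∑' n : ℕ, 3 * (n : ℝ) ^ (-2 : ℝ)) / c),
    hll.eventually_gt_atTop 0] with τ h1 h2 h3 h4 h5 h6 s hs hsτ
  rcases le_total 2 s.re with hs2 | hs2
  · refine (norm_LFunction_le_of_two_le_re χ hs2).trans ?_
    rwa [div_le_iff₀' hcpos] at h5
  set N := ⌊Real.log τ ^ κ⌋₊ with hNdef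
  have hN2 : 2 ≤ N := le_trans hq h2
  have hN2' : (2 : ℝ) ≤ N := mod_cast hN2
  have hlN : 0 < Real.log N := Real.log_pos (by linarith)
  have hlτ : 0 < Real.log τ := Real.log_pos (by linarith)
  have h7 : Real.log N ≤ κ * Real.log (Real.log τ) := by
    rw [← Real.log_rpow hlτ]
    exact Real.log_le_log (by linarith) (Nat.floor_le (by positivity))
  have h8 := hF N hN2 s hs hs2 (by linarith) (by rwa [sub_sub_cancel, hsτ])
  have h9 := re_sum_eulerTerm_le (by omega) χ h2 hs
  have h10 := (Complex.re_le_norm _).trans h8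
  rw [Complex.sub_re] at h10
  set E := ∑ n ∈ Finset.Icc 0 N, eulerLog n
  rw [← hexp s (by linarith), Complex.norm_exp]
  calc Real.exp (ℓ s).re
      ≤ Real.exp (C / Real.log N + (E - Real.log (Real.log N)) + Real.log B +
          Real.log (Real.log N)) := Real.exp_le_exp.2 (by linarith)
    _ = B * Real.exp (C / Real.log N + (E - Real.log (Real.log N))) * Real.log N := by
        rw [Real.exp_add, Real.exp_add _ (Real.log B), Real.exp_log hφ, Real.exp_log hlN]
        ring
    _ ≤ B * Real.exp (C / Real.log N + (E - Real.log (Real.log N))) *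
          (κ * Real.log (Real.log τ)) := by gcongr
    _ = B * κ * Real.exp (C / Real.log N + (E - Real.log (Real.log N))) *
          Real.log (Real.log τ) := by ring
    _ ≤ c * Real.log (Real.log τ) := by gcongr

end

open Complex DirichletCharacter ArithmeticFunction Finset

/-- **Theorem 1.** Assume GRH for `χ`. Then the values of `|L(ρ',χ)|` at critical points `ρ'` of
the Riemann zeta function with `Re ρ' ≥ 1` satisfy
`limsup |L(ρ',χ)| / log log (Im ρ') ≤ 2 e^{C₀} φ(q)/q` as `Im ρ' → ∞`. -/
theorem extreme_values_upper_bound (q : ℕ) [NeZero q] (hq : 2 < q)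
    (χ : DirichletCharacter ℂ q) (hχ : χ.IsPrimitive)
    (hGRH : ∀ s : ℂ, LFunction χ s = 0 → 0 < s.re → s.re < 1 → s.re = 1 / 2) :
    ∀ ε : ℝ, 0 < ε → ∃ T₀ : ℝ, 4 ≤ T₀ ∧
      ∀ ρ' : ℂ, deriv riemannZeta ρ' = 0 → 1 ≤ ρ'.re → T₀ ≤ ρ'.im →
        ‖LFunction χ ρ'‖ ≤
          (2 * Real.exp Real.eulerMascheroniConstant * (Nat.totient q : ℝ) / q + ε) *
            Real.log (Real.log ρ'.im) := by
  intro ε hε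
  have h0 (s : ℂ) (hs : 1 / 2 < s.re) : LFunction χ s ≠ 0 := by
    intro h
    rcases lt_or_ge s.re 1 with hs1 | hs1
    · exact hs.ne' (hGRH s h (by linarith) hs1)
    · exact LFunction_ne_zero_of_one_le_re χ
        (Or.inl (DirichletCharacter.ne_one_of_isPrimitive (by omega) hχ)) hs1 h
  obtain ⟨T, hT⟩ := Filter.eventually_atTop.1 (eventually_norm_LFunction_le (by omega)
    (DirichletCharacter.ne_one_of_isPrimitive (by omega) hχ) h0
    (c := 2 * Real.exp Real.eulerMascheroniConstant * (Nat.totient q : ℝ) / q + ε)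
    (by rw [mul_div_assoc]; linarith))
  exact ⟨max 4 T, le_max_left _ _, fun ρ' _ h1 h2 ↦
    hT ρ'.im ((le_max_right _ _).trans h2) ρ' h1 rfl⟩
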